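/- arXiv:1911.12294 — 6 statements merged into one kernel-verified Lean document; each statement's English description precedes it below -/
import Mathlib

section
/- Let β < γ be real numbers and let F be holomorphic on the strip {z ∈ ℂ : β < Re z < γ} such that for every ε > 0 and every m ∈ ℕ one has sup{(1+|Im z|)^m |F(z)| : β+ε ≤ Re z ≤ γ−ε} < ∞. Then there exists a function f ∈ C^∞((0,∞)) such that: (i) for every ρ ∈ (β,γ) and every t > 0, f(t) = (1/(2πi)) ∫_{Re z = ρ} t^{−z} F(z) dz, this contour integral being absolutely convergent and independent of ρ; (ii) for every ε > 0, f(t) = O(t^{−β−ε}) as t → 0⁺ and f(t) = O(t^{−γ+ε}) as t → ∞; (iii) for every z with β < Re z < γ, the integral ∫₀^∞ t^{z−1} f(t) dt converges absolutely and equals F(z). -/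
open MeasureTheory Set Filter Topology Asymptotics

/-- A continuous function of order `|y| ^ (-n - 2)` has an integrable `n`-th moment. -/
theorem integrable_norm_pow_mul_of_decay {G : ℝ → ℂ} (hG : Continuous G) {n : ℕ} {M : ℝ}
    (hM : ∀ y, (1 + |y|) ^ (n + 2) * ‖G y‖ ≤ M) : Integrable (fun y => ‖y‖ ^ n * ‖G y‖) := by
  refine (integrable_inv_one_add_sq.const_mul M).mono' (by fun_prop) (.of_forall fun y => ?_)
  have h1 : 0 < 1 + y ^ 2 := by positivity
  rw [Real.norm_of_nonneg (by positivity), ← div_eq_mul_inv, le_div_iff₀ h1]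
  refine le_trans ?_ (hM y)
  have h2 : ‖y‖ ^ n ≤ (1 + |y|) ^ n := by
    rw [Real.norm_eq_abs]; gcongr; linarith
  have h3 : 1 + y ^ 2 ≤ (1 + |y|) ^ 2 := by
    nlinarith [sq_abs y, abs_nonneg y]
  calc ‖y‖ ^ n * ‖G y‖ * (1 + y ^ 2) = ‖y‖ ^ n * (1 + y ^ 2) * ‖G y‖ := by ring
    _ ≤ (1 + |y|) ^ n * (1 + |y|) ^ 2 * ‖G y‖ := by gcongr
    _ = _ := by rw [pow_add]

theorem integrable_of_decay {G : ℝ → ℂ} (hG : Continuous G) {M : ℝ}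
    (hM : ∀ y, (1 + |y|) ^ 2 * ‖G y‖ ≤ M) : Integrable G := by
  have h := integrable_norm_pow_mul_of_decay hG (n := 0) (by simpa using hM)
  simp only [pow_zero, one_mul] at h
  exact (integrable_norm_iff hG.aestronglyMeasurable).1 h

theorem continuous_comp_vertical_line {H : ℂ → ℂ} {S : Set ℂ} (hH : ContinuousOn H S) {σ c : ℝ}
    (hσ : ∀ z : ℂ, z.re = σ → z ∈ S) : Continuous fun y : ℝ => H (σ + c * y * Complex.I) :=
  hH.comp_continuous (by fun_prop) fun y => hσ _ (by simp)

/-- Shifting the contour of integration between two vertical lines, for a function holomorphic and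
decaying on the closed strip between them. -/
theorem integral_vertical_line_eq {H : ℂ → ℂ} {a b C : ℝ} (hab : a ≤ b)
    (hd : DifferentiableOn ℂ H {z | a ≤ z.re ∧ z.re ≤ b})
    (hC : ∀ z : ℂ, a ≤ z.re → z.re ≤ b → (1 + |z.im|) ^ 2 * ‖H z‖ ≤ C) :
    ∫ y : ℝ, H (a + y * Complex.I) = ∫ y : ℝ, H (b + y * Complex.I) := by
  have hintegrable : ∀ σ : ℝ, a ≤ σ → σ ≤ b → Integrable fun y : ℝ => H (σ + y * Complex.I) := by
    intro σ h1 h2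
    refine integrable_of_decay (M := C) ?_ fun y => by
      simpa using hC (σ + y * Complex.I) (by simpa) (by simpa)
    simpa using continuous_comp_vertical_line (c := 1) hd.continuousOn
      (fun z (hz : z.re = σ) => ⟨hz ▸ h1, hz ▸ h2⟩)
  have hlim : ∀ σ : ℝ, a ≤ σ → σ ≤ b → Tendsto
      (fun T : ℝ => ∫ y in (-T)..T, H (σ + y * Complex.I)) atTop
      (𝓝 (∫ y : ℝ, H (σ + y * Complex.I))) := fun σ h1 h2 =>
    intervalIntegral_tendsto_integral (hintegrable σ h1 h2) tendsto_neg_atTop_atBot tendsto_id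
  have hhor : ∀ e : ℝ, |e| = 1 → Tendsto
      (fun T : ℝ => ∫ x in a..b, H (x + (e * T : ℝ) * Complex.I)) atTop (𝓝 0) := by
    intro e he
    have h0 : Tendsto (fun T : ℝ => C / (1 + T) ^ 2 * |b - a|) atTop (𝓝 0) := by
      have : Tendsto (fun T : ℝ => (1 + T) ^ 2) atTop atTop :=
        (tendsto_pow_atTop two_ne_zero).comp (tendsto_atTop_add_const_left _ _ tendsto_id)
      simpa using (this.const_div_atTop C).mul_const |b - a|
    refine squeeze_zero_norm' ?_ h0
    filter_upwards [eventually_ge_atTop 0] with T hT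
    refine intervalIntegral.norm_integral_le_of_norm_le_const fun x hx => ?_
    rw [uIoc_of_le hab] at hx
    have := hC (x + (e * T : ℝ) * Complex.I) (by simpa using hx.1.le) (by simpa using hx.2)
    have him : |(x + (e * T : ℝ) * Complex.I : ℂ).im| = T := by
      simp [abs_mul, he, abs_of_nonneg hT]
    rw [him] at this
    rw [le_div_iff₀ (by positivity)]
    linarith
  have hcauchy : ∀ T : ℝ, (∫ x in a..b, H (x + (-1 * T : ℝ) * Complex.I)) -
      (∫ x in a..b, H (x + (1 * T : ℝ) * Complex.I)) +
      Complex.I * (∫ y in (-T)..T, H (b + y * Complex.I)) -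
      Complex.I * (∫ y in (-T)..T, H (a + y * Complex.I)) = 0 := by
    intro T
    have := Complex.integral_boundary_rect_eq_zero_of_differentiableOn H
      ⟨a, -T⟩ ⟨b, T⟩ (hd.mono fun z hz => by
        have := hz.1
        rw [mem_preimage, uIcc_of_le hab] at this
        exact this)
    simpa using this
  have hsum := ((((hhor (-1) (by simp)).sub (hhor 1 (by simp))).add
    ((hlim b hab le_rfl).const_mul Complex.I)).sub ((hlim a le_rfl hab).const_mul Complex.I))
  have := tendsto_nhds_unique (hsum.congr hcauchy) tendsto_const_nhds
  have h2 : Complex.I * ((∫ y : ℝ, H (b + y * Complex.I)) - ∫ y : ℝ, H (a + y * Complex.I)) = 0 := by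
    linear_combination this
  exact (sub_eq_zero.1 ((mul_eq_zero.1 h2).resolve_left Complex.I_ne_zero)).symm

/-- If `F` has integrable moments of all orders on a vertical line, its inverse Mellin transform
is smooth on the positive half-line. -/
theorem contDiffOn_mellinInv {F : ℂ → ℂ} {σ : ℝ}
    (hF : ∀ n : ℕ, Integrable fun y : ℝ => ‖y‖ ^ n * ‖F (σ + 2 * Real.pi * y * Complex.I)‖) :
    ContDiffOn ℝ (⊤ : ℕ∞) (mellinInv σ F) (Ioi 0) := by
  have hcd := Real.contDiff_fourier (N := ⊤)
    (f := fun y : ℝ => F (σ + 2 * Real.pi * y * Complex.I)) fun n _ => hF n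
  have hlog : ContDiffOn ℝ (⊤ : ℕ∞) Real.log (Ioi 0) :=
    Real.contDiffOn_log.mono fun x (hx : 0 < x) => hx.ne'
  have hexp : ContDiff ℝ (⊤ : ℕ∞) fun u : ℝ => ((Real.exp (u * -σ) : ℝ) : ℂ) :=
    Complex.ofRealCLM.contDiff.comp (Real.contDiff_exp.comp (contDiff_id.mul contDiff_const))
  refine ((hexp.comp_contDiffOn hlog).mul (hcd.comp_contDiffOn hlog)).congr fun x hx => ?_
  have hx : 0 < x := hx
  rw [mellinInv_eq_fourierInv _ _ hx, Real.fourierInv_eq_fourier_neg, neg_neg, smul_eq_mul]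
  congr 1
  rw [Function.comp_apply, ← Real.rpow_def_of_pos hx, Complex.ofReal_cpow hx.le,
    Complex.ofReal_neg]

/-- The Mellin transform is a left inverse of the inverse Mellin transform. -/
theorem mellin_mellinInv_eq {F : ℂ → ℂ} {σ : ℝ}
    (hc : Continuous fun y : ℝ => F (σ + 2 * Real.pi * y * Complex.I))
    (hF : Integrable fun y : ℝ => F (σ + 2 * Real.pi * y * Complex.I))
    (hconv : MellinConvergent (mellinInv σ F) σ) (τ : ℝ) :
    mellin (mellinInv σ F) (σ + τ * Complex.I) = F (σ + τ * Complex.I) := by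
  set g : ℝ → ℂ := fun y => F (σ + 2 * Real.pi * y * Complex.I) with hg
  have hinv : (fun u : ℝ => Real.exp (-σ * u) • mellinInv σ F (Real.exp (-u))) =
      FourierTransformInv.fourierInv g := by
    ext u
    rw [mellinInv_eq_fourierInv _ _ (Real.exp_pos _), Real.log_exp, neg_neg,
      Complex.real_smul, smul_eq_mul, ← mul_assoc, ← Complex.ofReal_neg,
      ← Complex.ofReal_cpow (Real.exp_pos _).le, ← Complex.ofReal_mul, ← Real.exp_mul,
      ← Real.exp_add]
    simp [show -(σ * u) + u * σ = 0 by ring, hg]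
  have hintegrable : Integrable (FourierTransformInv.fourierInv g) := by
    rw [← hinv]
    have himg : (fun u : ℝ => Real.exp (-u)) '' univ = Ioi 0 := by
      rw [image_univ]
      ext x
      exact ⟨fun ⟨u, hu⟩ => hu ▸ Real.exp_pos _,
        fun hx => ⟨-Real.log x, by simp [Real.exp_log (show 0 < x from hx)]⟩⟩
    have hderiv : ∀ x ∈ (univ : Set ℝ),
        HasDerivWithinAt (fun u : ℝ => Real.exp (-u)) (-Real.exp (-x)) univ x := fun x _ => by
      simpa using (hasDerivAt_neg x).exp
    rw [MellinConvergent, ← himg, integrableOn_image_iff_integrableOn_abs_deriv_smul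
      MeasurableSet.univ hderiv (Real.exp_injective.comp neg_injective).injOn,
      integrableOn_univ] at hconv
    refine hconv.congr (.of_forall fun u => ?_)
    simp only [abs_neg, Real.abs_exp]
    rw [← Complex.ofReal_one, ← Complex.ofReal_sub, ← Complex.ofReal_cpow (Real.exp_pos _).le,
      ← Real.exp_mul, Complex.real_smul, smul_eq_mul, Complex.real_smul, ← mul_assoc,
      ← Complex.ofReal_mul, ← Real.exp_add]
    ring_nf
  have hintegrable' : Integrable (FourierTransform.fourier g) := by
    have := hintegrable.comp_neg
    simpa [Real.fourierInv_eq_fourier_neg] using this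
  rw [mellin_eq_fourier]
  have : (σ + τ * Complex.I : ℂ).re = σ := by simp
  have h2 : (σ + τ * Complex.I : ℂ).im = τ := by simp
  rw [this, h2, hinv, hc.fourier_fourierInv_eq hF hintegrable', hg]
  have hpi : (Real.pi : ℂ) ≠ 0 := by exact_mod_cast Real.pi_ne_zero
  dsimp only
  congr 2
  push_cast
  field_simp

theorem norm_mellinInv_le (F : ℂ → ℂ) (σ : ℝ) {t : ℝ} (ht : 0 < t) :
    ‖mellinInv σ F t‖ ≤
      (1 / (2 * Real.pi) * ∫ y : ℝ, ‖F (σ + y * Complex.I)‖) * t ^ (-σ) := by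
  rw [mellinInv, norm_smul, Real.norm_of_nonneg (by positivity), mul_assoc]
  gcongr
  refine (norm_integral_le_integral_norm _).trans_eq ?_
  simp [Complex.norm_cpow_eq_rpow_re_of_pos ht, integral_const_mul, mul_comm]

theorem mellinInv_eq_of_decay {F : ℂ → ℂ} {a b M : ℝ} (hab : a ≤ b)
    (hd : DifferentiableOn ℂ F {z | a ≤ z.re ∧ z.re ≤ b})
    (hM : ∀ z : ℂ, a ≤ z.re → z.re ≤ b → (1 + |z.im|) ^ 2 * ‖F z‖ ≤ M) {t : ℝ} (ht : 0 < t) :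
    mellinInv a F t = mellinInv b F t := by
  have htc : (t : ℂ) ≠ 0 := by exact_mod_cast ht.ne'
  rw [mellinInv, mellinInv]
  congr 1
  refine integral_vertical_line_eq (H := fun z => (t : ℂ) ^ (-z) • F z)
    (C := (t ^ (-a) + t ^ (-b)) * M) hab ?_ fun z ha hb => ?_
  · exact DifferentiableOn.smul
      (fun z _ => ((differentiableAt_id.neg).const_cpow (.inl htc)).differentiableWithinAt) hd
  · have hM' := hM z ha hb
    rw [norm_smul, Complex.norm_cpow_eq_rpow_re_of_pos ht, Complex.neg_re]
    have hle : t ^ (-z.re) ≤ t ^ (-a) + t ^ (-b) := by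
      have h1 := Real.rpow_pos_of_pos ht (-a)
      have h2 := Real.rpow_pos_of_pos ht (-b)
      rcases le_total 1 t with h | h
      · have := Real.rpow_le_rpow_of_exponent_le h (neg_le_neg ha)
        linarith
      · have := Real.rpow_le_rpow_of_exponent_ge ht h (neg_le_neg hb)
        linarith
    calc (1 + |z.im|) ^ 2 * (t ^ (-z.re) * ‖F z‖)
        = t ^ (-z.re) * ((1 + |z.im|) ^ 2 * ‖F z‖) := by ring
      _ ≤ _ := by gcongr

/-- Mellin inversion, Lemma 2.1: if `F` is holomorphic and rapidly decreasing in
the strip `β < Re z < γ`, then `F` is the Mellin transform of a smooth function `f` on `(0,∞)`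
given by the inverse Mellin integral, with the stated decay as `t → 0⁺` and `t → ∞`. -/
theorem mellin_inversion_strip (β γ : ℝ) (hβγ : β < γ) (F : ℂ → ℂ)
    (hF : DifferentiableOn ℂ F {z : ℂ | β < z.re ∧ z.re < γ})
    (hdecay : ∀ ε > 0, ∀ m : ℕ, ∃ M : ℝ, ∀ z : ℂ, β + ε ≤ z.re → z.re ≤ γ - ε →
      (1 + |z.im|) ^ m * ‖F z‖ ≤ M) :
    ∃ f : ℝ → ℂ,
      ContDiffOn ℝ (⊤ : ℕ∞) f (Ioi 0) ∧
      -- (i) inverse Mellin formula, absolutely convergent and independent of `ρ ∈ (β,γ)`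
      (∀ ρ : ℝ, β < ρ → ρ < γ → ∀ t : ℝ, 0 < t →
        Integrable (fun y : ℝ =>
          (t : ℂ) ^ (-(((ρ : ℂ) + (y : ℂ) * Complex.I))) * F ((ρ : ℂ) + (y : ℂ) * Complex.I)) ∧
        f t = (2 * Real.pi * Complex.I)⁻¹ *
          ∫ y : ℝ, (t : ℂ) ^ (-(((ρ : ℂ) + (y : ℂ) * Complex.I))) *
            F ((ρ : ℂ) + (y : ℂ) * Complex.I) * Complex.I) ∧
      -- (ii) decay at `0⁺` and at `∞`
      (∀ ε > 0,
        f =O[nhdsWithin 0 (Ioi 0)] (fun t : ℝ => t ^ (-β - ε)) ∧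
        f =O[atTop] (fun t : ℝ => t ^ (-γ + ε))) ∧
      -- (iii) the Mellin transform of `f` is `F` on the strip
      (∀ z : ℂ, β < z.re → z.re < γ →
        IntegrableOn (fun t : ℝ => (t : ℂ) ^ (z - 1) * f t) (Ioi 0) ∧
        (∫ t in Ioi (0 : ℝ), (t : ℂ) ^ (z - 1) * f t) = F z) := by
  have hdec : ∀ a b : ℝ, β < a → b < γ → ∀ m : ℕ, ∃ M : ℝ, ∀ z : ℂ, a ≤ z.re → z.re ≤ b →
      (1 + |z.im|) ^ m * ‖F z‖ ≤ M := by
    intro a b ha hb m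
    obtain ⟨M, hM⟩ := hdecay (min (a - β) (γ - b)) (lt_min (by linarith) (by linarith)) m
    exact ⟨M, fun z h1 h2 => hM z (by linarith [min_le_left (a - β) (γ - b)])
      (by linarith [min_le_right (a - β) (γ - b)])⟩
  have hcont : ∀ σ c : ℝ, β < σ → σ < γ → Continuous fun y : ℝ => F (σ + c * y * Complex.I) :=
    fun σ c h1 h2 => continuous_comp_vertical_line hF.continuousOn
      fun z hz => ⟨hz ▸ h1, hz ▸ h2⟩
  have hmom : ∀ σ c : ℝ, β < σ → σ < γ → 1 ≤ c → ∀ n : ℕ,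
      Integrable fun y : ℝ => ‖y‖ ^ n * ‖F (σ + c * y * Complex.I)‖ := by
    intro σ c h1 h2 hc n
    obtain ⟨M, hM⟩ := hdec σ σ h1 h2 (n + 2)
    refine integrable_norm_pow_mul_of_decay (hcont σ c h1 h2) (M := M) fun y => ?_
    refine le_trans ?_ (hM (σ + c * y * Complex.I) (by simp) (by simp))
    have him : (σ + c * y * Complex.I : ℂ).im = c * y := by simp
    rw [him, abs_mul, abs_of_pos (by linarith : 0 < c)]
    gcongr
    exact le_mul_of_one_le_left (abs_nonneg y) hc
  have hintegrable : ∀ σ c : ℝ, β < σ → σ < γ → 1 ≤ c →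
      Integrable fun y : ℝ => F (σ + c * y * Complex.I) := fun σ c h1 h2 hc =>
    (integrable_norm_iff (hcont σ c h1 h2).aestronglyMeasurable).1
      (by simpa using hmom σ c h1 h2 hc 0)
  have hshift : ∀ a b : ℝ, β < a → a ≤ b → b < γ → ∀ t : ℝ, 0 < t →
      mellinInv a F t = mellinInv b F t := by
    intro a b ha hab hb t ht
    obtain ⟨M, hM⟩ := hdec a b ha hb 2
    exact mellinInv_eq_of_decay hab
      (hF.mono fun z hz => ⟨ha.trans_le hz.1, hz.2.trans_lt hb⟩) hM ht
  have hpi : 1 ≤ 2 * Real.pi := by linarith [Real.pi_gt_three]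
  obtain ⟨σ, hσ1, hσ2⟩ := exists_between hβγ
  have heq : ∀ ρ : ℝ, β < ρ → ρ < γ → ∀ t : ℝ, 0 < t →
      mellinInv σ F t = mellinInv ρ F t := by
    intro ρ h1 h2 t ht
    rcases le_total σ ρ with h | h
    · exact hshift σ ρ hσ1 h h2 t ht
    · exact (hshift ρ σ h1 h hσ2 t ht).symm
  have hbound : ∀ ρ : ℝ, β < ρ → ρ < γ → ∃ C : ℝ, ∀ t : ℝ, 0 < t →
      ‖mellinInv σ F t‖ ≤ C * t ^ (-ρ) := fun ρ h1 h2 =>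
    ⟨_, fun t ht => heq ρ h1 h2 t ht ▸ norm_mellinInv_le F ρ ht⟩
  have hsmooth : ContDiffOn ℝ (⊤ : ℕ∞) (mellinInv σ F) (Ioi 0) :=
    contDiffOn_mellinInv fun n => by simpa using hmom σ (2 * Real.pi) hσ1 hσ2 hpi n
  have hzero : ∀ ρ : ℝ, β < ρ → ρ < γ →
      mellinInv σ F =O[nhdsWithin 0 (Ioi 0)] fun t : ℝ => t ^ (-ρ) := by
    intro ρ h1 h2
    obtain ⟨C, hC⟩ := hbound ρ h1 h2
    refine .of_bound C ?_
    filter_upwards [self_mem_nhdsWithin] with t ht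
    rw [Real.norm_of_nonneg (Real.rpow_nonneg (le_of_lt ht) _)]
    exact hC t ht
  have htop : ∀ ρ : ℝ, β < ρ → ρ < γ →
      mellinInv σ F =O[atTop] fun t : ℝ => t ^ (-ρ) := by
    intro ρ h1 h2
    obtain ⟨C, hC⟩ := hbound ρ h1 h2
    refine .of_bound C ?_
    filter_upwards [eventually_gt_atTop 0] with t ht
    rw [Real.norm_of_nonneg (Real.rpow_nonneg ht.le _)]
    exact hC t ht
  have hmellin : ∀ z : ℂ, β < z.re → z.re < γ → MellinConvergent (mellinInv σ F) z := by
    intro z h1 h2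
    obtain ⟨a, ha1, ha2⟩ := exists_between h1
    obtain ⟨b, hb1, hb2⟩ := exists_between h2
    exact mellinConvergent_of_isBigO_rpow
      (hsmooth.continuousOn.locallyIntegrableOn measurableSet_Ioi)
      (htop b (h1.trans hb1) hb2) hb1 (hzero a ha1 (ha2.trans h2)) ha2
  refine ⟨mellinInv σ F, hsmooth, fun ρ h1 h2 t ht => ⟨?_, ?_⟩, fun ε hε => ⟨?_, ?_⟩,
    fun z h1 h2 => ⟨hmellin z h1 h2, ?_⟩⟩
  · have htc : (t : ℂ) ≠ 0 := by exact_mod_cast ht.ne'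
    have hFi : Integrable fun y : ℝ => F (ρ + y * Complex.I) := by
      simpa using hintegrable ρ 1 h1 h2 le_rfl
    have hpow : Continuous fun y : ℝ => (t : ℂ) ^ (-((ρ : ℂ) + (y : ℂ) * Complex.I)) :=
      Continuous.const_cpow (by fun_prop) (.inl htc)
    refine hFi.bdd_mul (c := t ^ (-ρ)) hpow.aestronglyMeasurable (.of_forall fun y => ?_)
    simp [Complex.norm_cpow_eq_rpow_re_of_pos ht]
  · rw [heq ρ h1 h2 t ht, mellinInv, integral_mul_const, Complex.real_smul]
    simp only [smul_eq_mul]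
    have hpi0 : (Real.pi : ℂ) ≠ 0 := by exact_mod_cast Real.pi_ne_zero
    generalize (∫ y : ℝ, (t : ℂ) ^ (-((ρ : ℂ) + (y : ℂ) * Complex.I)) *
      F ((ρ : ℂ) + (y : ℂ) * Complex.I)) = J
    push_cast
    field_simp
  · obtain ⟨ρ, h1, h2⟩ := exists_between (lt_min hβγ (by linarith : β < β + ε))
    rw [lt_min_iff] at h2
    refine (hzero ρ h1 h2.1).trans (.of_bound 1 ?_)
    filter_upwards [Ioo_mem_nhdsGT (zero_lt_one' ℝ)] with t ht
    rw [one_mul, Real.norm_of_nonneg (Real.rpow_nonneg ht.1.le _),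
      Real.norm_of_nonneg (Real.rpow_nonneg ht.1.le _)]
    exact Real.rpow_le_rpow_of_exponent_ge ht.1 ht.2.le (by linarith [h2.2])
  · obtain ⟨ρ, h1, h2⟩ := exists_between (max_lt hβγ (by linarith : γ - ε < γ))
    rw [max_lt_iff] at h1
    refine (htop ρ h1.1 h2).trans (.of_bound 1 ?_)
    filter_upwards [eventually_ge_atTop 1] with t ht
    have ht0 : 0 ≤ t := zero_le_one.trans ht
    rw [one_mul, Real.norm_of_nonneg (Real.rpow_nonneg ht0 _),
      Real.norm_of_nonneg (Real.rpow_nonneg ht0 _)]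
    exact Real.rpow_le_rpow_of_exponent_le ht (by linarith [h1.2])
  · have hcongr : ∀ s : ℂ, ∀ t ∈ Ioi (0 : ℝ), (t : ℂ) ^ (s - 1) • mellinInv σ F t =
        (t : ℂ) ^ (s - 1) • mellinInv z.re F t := fun s t ht => by rw [heq z.re h1 h2 t ht]
    have hconv : MellinConvergent (mellinInv z.re F) z.re :=
      (hmellin z.re (by simpa) (by simpa)).congr_fun (hcongr _) measurableSet_Ioi
    have hmain := mellin_mellinInv_eq (by simpa using hcont z.re (2 * Real.pi) h1 h2)
      (by simpa using hintegrable z.re (2 * Real.pi) h1 h2 hpi) hconv z.im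
    rw [Complex.re_add_im] at hmain
    rw [← hmain, mellin]
    exact setIntegral_congr_fun measurableSet_Ioi (hcongr z)
end

section
/- Let 1/2 < η ≤ 1. There is a constant C > 0, depending only on η, such that for every f ∈ C_c^∞((0,∞)) (smooth, compactly supported in (0,∞)) and every μ ∈ ℂ with 1/2 − η < Re μ ≤ 0, one has |f̂(μ)|² ≤ C [ (Re μ + η − 1/2)^{−1} ∫_{Re z = 1/2−η} (1+|z|²)^η |f̂(z)|² |dz| + ∫_{Re z = 1/2} |f̂(z)|² |dz| ], where f̂(z) = ∫₀^∞ s^{z−1} f(s) ds (which is entire since f is smooth and compactly supported in (0,∞)). -/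
open MeasureTheory Set
open scoped ContDiff SchwartzMap FourierTransform
open Real

theorem sq_integral_mul_le {α : Type*} [MeasurableSpace α] {μ : Measure α} {f g : α → ℝ}
    (hf₀ : 0 ≤ᵐ[μ] f) (hg₀ : 0 ≤ᵐ[μ] g) (hf : MemLp f 2 μ) (hg : MemLp g 2 μ) :
    (∫ a, f a * g a ∂μ) ^ 2 ≤ (∫ a, f a ^ 2 ∂μ) * ∫ a, g a ^ 2 ∂μ := by
  have h := integral_mul_le_Lp_mul_Lq_of_nonneg Real.HolderConjugate.two_two hf₀ hg₀
    (by simpa using hf) (by simpa using hg)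
  simp only [Real.rpow_two, ← Real.sqrt_eq_rpow] at h
  have h0 : 0 ≤ ∫ a, f a * g a ∂μ := integral_nonneg_of_ae (by
    filter_upwards [hf₀, hg₀] with x hx hy using mul_nonneg hx hy)
  calc _ ≤ _ := pow_le_pow_left₀ h0 h 2
    _ = _ := by
      rw [mul_pow, Real.sq_sqrt (integral_nonneg fun _ => sq_nonneg _),
        Real.sq_sqrt (integral_nonneg fun _ => sq_nonneg _)]

theorem HasCompactSupport.comp_exp_neg {E : Type*} [NormedAddCommGroup E] {f : ℝ → E}
    (hf : HasCompactSupport f) (hf₀ : tsupport f ⊆ Ioi 0) :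
    HasCompactSupport fun u : ℝ => f (rexp (-u)) := by
  have hK : IsCompact ((fun s : ℝ => -Real.log s) '' tsupport f) :=
    hf.isCompact.image_of_continuousOn
      ((Real.continuousOn_log.mono fun s hs => (hf₀ hs).ne').neg)
  refine HasCompactSupport.intro hK fun u hu => ?_
  by_contra h
  exact hu ⟨rexp (-u), subset_tsupport f h, by simp⟩

theorem SchwartzMap.memLp_two_norm (φ : 𝓢(ℝ, ℂ)) : MemLp (fun u => ‖φ u‖) 2 :=
  (φ.memLp 2).norm

theorem SchwartzMap.integrable_norm_sq (φ : 𝓢(ℝ, ℂ)) : Integrable fun u => ‖φ u‖ ^ 2 :=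
  (φ.memLp_two_norm).integrable_sq

theorem SchwartzMap.integrable_sq_mul_norm_sq (φ : 𝓢(ℝ, ℂ)) :
    Integrable fun u => u ^ 2 * ‖φ u‖ ^ 2 := by
  refine ((φ.integrable_pow_mul volume 2).mul_const (SchwartzMap.seminorm ℝ 0 0 φ)).mono'
    (by fun_prop) (.of_forall fun u => ?_)
  have h := φ.norm_le_seminorm ℝ u
  rw [Real.norm_of_nonneg (by positivity), Real.norm_eq_abs, sq_abs, mul_assoc, sq ‖φ u‖]
  gcongr

/-- The function `u ↦ e^{-σ u} f(e^{-u})` whose Fourier transform is the Mellin transform of `f`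
on the line `Re z = σ`, as a Schwartz function. -/
noncomputable def mellinSchwartz {f : ℝ → ℂ} (hf : ContDiff ℝ ∞ f) (hc : HasCompactSupport f)
    (hs : tsupport f ⊆ Ioi 0) (σ : ℝ) : 𝓢(ℝ, ℂ) :=
  HasCompactSupport.toSchwartzMap (f := fun u : ℝ => rexp (-σ * u) • f (rexp (-u)))
    ((hc.comp_exp_neg hs).smul_left (f := fun u : ℝ => rexp (-σ * u)))
    (ContDiff.smul (f := fun u : ℝ => rexp (-σ * u)) (by fun_prop)
      (hf.comp (f := fun u : ℝ => rexp (-u)) (by fun_prop)))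

section

variable {f : ℝ → ℂ} (hf : ContDiff ℝ ∞ f) (hc : HasCompactSupport f) (hs : tsupport f ⊆ Ioi 0)

theorem mellinSchwartz_apply (σ u : ℝ) :
    mellinSchwartz hf hc hs σ u = rexp (-σ * u) • f (rexp (-u)) := rfl

theorem norm_mellinSchwartz_apply (σ u : ℝ) :
    ‖mellinSchwartz hf hc hs σ u‖ = rexp (-σ * u) * ‖f (rexp (-u))‖ := by
  rw [mellinSchwartz_apply, norm_smul, Real.norm_of_nonneg (exp_nonneg _)]

theorem norm_mellinSchwartz_eq_exp_mul (σ τ u : ℝ) :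
    ‖mellinSchwartz hf hc hs σ u‖ = rexp ((τ - σ) * u) * ‖mellinSchwartz hf hc hs τ u‖ := by
  rw [norm_mellinSchwartz_apply, norm_mellinSchwartz_apply, ← mul_assoc, ← Real.exp_add]
  ring_nf

theorem mellin_eq_fourier_mellinSchwartz (z : ℂ) :
    mellin f z = 𝓕 (mellinSchwartz hf hc hs z.re) (z.im / (2 * π)) := by
  rw [mellin_eq_fourier, SchwartzMap.fourier_coe]
  rfl

theorem mellin_line_eq_fourier (σ t : ℝ) :
    mellin f (σ + t * Complex.I) = 𝓕 (mellinSchwartz hf hc hs σ) (t / (2 * π)) := by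
  rw [mellin_eq_fourier_mellinSchwartz hf hc hs]
  simp

theorem norm_mellin_le (z : ℂ) :
    ‖mellin f z‖ ≤ ∫ u, ‖mellinSchwartz hf hc hs z.re u‖ := by
  rw [mellin_eq_fourier_mellinSchwartz hf hc hs, SchwartzMap.fourier_coe]
  exact VectorFourier.norm_fourierIntegral_le_integral_norm _ _ _ _ _

theorem integral_norm_sq_mellin_line (σ : ℝ) :
    ∫ t : ℝ, ‖mellin f (σ + t * Complex.I)‖ ^ 2 =
      2 * π * ∫ u, ‖mellinSchwartz hf hc hs σ u‖ ^ 2 := by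
  simp_rw [mellin_line_eq_fourier hf hc hs]
  rw [Measure.integral_comp_div (fun y => ‖𝓕 (mellinSchwartz hf hc hs σ) y‖ ^ 2),
    abs_of_pos (by positivity), smul_eq_mul, SchwartzMap.integral_norm_sq_fourier]

end

theorem integrable_weight_mul_norm_sq_mellin_line {f : ℝ → ℂ} (hf : ContDiff ℝ ∞ f) (hc : HasCompactSupport f)
    (hs : tsupport f ⊆ Ioi 0) {η : ℝ} (hη : η ≤ 1) (σ : ℝ) :
    Integrable fun t : ℝ => (1 + ‖(σ : ℂ) + t * Complex.I‖ ^ 2) ^ η *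
      ‖mellin f (σ + t * Complex.I)‖ ^ 2 := by
  simp_rw [mellin_line_eq_fourier hf hc hs]
  set φ := 𝓕 (mellinSchwartz hf hc hs σ)
  have hb : Integrable fun t : ℝ =>
      (1 + σ ^ 2 + (2 * π) ^ 2 * (t / (2 * π)) ^ 2) * ‖φ (t / (2 * π))‖ ^ 2 := by
    refine Integrable.comp_div (R := 2 * π)
      (g := fun y => (1 + σ ^ 2 + (2 * π) ^ 2 * y ^ 2) * ‖φ y‖ ^ 2) ?_ (by positivity)
    simp_rw [add_mul _ _ (‖φ _‖ ^ 2), mul_assoc _ _ (‖φ _‖ ^ 2)]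
    exact ((φ.integrable_norm_sq.const_mul _).add
      (φ.integrable_norm_sq.const_mul _)).add (φ.integrable_sq_mul_norm_sq.const_mul _)
  refine hb.mono' ?_ (.of_forall fun t => ?_)
  · refine Continuous.aestronglyMeasurable (.mul (.rpow_const (by fun_prop) fun t => .inl ?_) ?_)
    · positivity
    · exact (φ.continuous.comp (by fun_prop)).norm.pow 2
  · rw [Real.norm_of_nonneg (by positivity)]
    gcongr
    calc (1 + ‖(σ : ℂ) + t * Complex.I‖ ^ 2) ^ η
        ≤ (1 + ‖(σ : ℂ) + t * Complex.I‖ ^ 2) ^ (1 : ℝ) :=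
          Real.rpow_le_rpow_of_exponent_le (by simp) hη
      _ = _ := by
        rw [Real.rpow_one, Complex.sq_norm, Complex.normSq_add_mul_I]
        field_simp
        ring

theorem integral_norm_sq_mellin_line_le {f : ℝ → ℂ} (hf : ContDiff ℝ ∞ f) (hc : HasCompactSupport f)
    (hs : tsupport f ⊆ Ioi 0) {η : ℝ} (hη₀ : 0 ≤ η) (hη : η ≤ 1) (σ : ℝ) :
    ∫ t : ℝ, ‖mellin f (σ + t * Complex.I)‖ ^ 2 ≤
      ∫ t : ℝ, (1 + ‖(σ : ℂ) + t * Complex.I‖ ^ 2) ^ η *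
        ‖mellin f (σ + t * Complex.I)‖ ^ 2 := by
  refine integral_mono_of_nonneg (.of_forall fun _ => by positivity)
    (integrable_weight_mul_norm_sq_mellin_line hf hc hs hη σ) (.of_forall fun t => ?_)
  exact le_mul_of_one_le_left (by positivity)
    (Real.one_le_rpow (by simp) hη₀)

/-- Cauchy–Schwarz for the change of weight from `e^{-τ u}` to `e^{-σ u}` on a set `S`. -/
theorem sq_setIntegral_norm_mellinSchwartz_le {f : ℝ → ℂ} (hf : ContDiff ℝ ∞ f)
    (hc : HasCompactSupport f) (hs : tsupport f ⊆ Ioi 0) {S : Set ℝ} {σ τ : ℝ}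
    (hS : IntegrableOn (fun u => rexp (2 * (τ - σ) * u)) S) :
    (∫ u in S, ‖mellinSchwartz hf hc hs σ u‖) ^ 2 ≤
      (∫ u in S, rexp (2 * (τ - σ) * u)) * ∫ u, ‖mellinSchwartz hf hc hs τ u‖ ^ 2 := by
  have hsq (u : ℝ) : rexp ((τ - σ) * u) ^ 2 = rexp (2 * (τ - σ) * u) := by
    rw [← Real.exp_nat_mul]; push_cast; ring_nf
  have hE : MemLp (fun u => rexp ((τ - σ) * u)) 2 (volume.restrict S) := by
    rw [memLp_two_iff_integrable_sq (by fun_prop)]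
    simpa only [hsq, IntegrableOn] using hS
  simp_rw [norm_mellinSchwartz_eq_exp_mul hf hc hs σ τ]
  calc _ ≤ _ := sq_integral_mul_le (.of_forall fun _ => exp_nonneg _)
        (.of_forall fun _ => norm_nonneg _) hE
        ((mellinSchwartz hf hc hs τ).memLp_two_norm.restrict S)
    _ ≤ _ := by
      simp_rw [hsq]
      gcongr ?_ * ?_
      exact setIntegral_le_integral (SchwartzMap.integrable_norm_sq _)
        (.of_forall fun _ => by positivity)

/-- Lemma 2.3: for `1/2 < η ≤ 1` there is `C > 0` such that for every
`f ∈ C_c^∞((0,∞))` and every `μ` with `1/2 − η < Re μ ≤ 0`, the Mellin transform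
`f̂(z) = ∫₀^∞ s^{z−1} f(s) ds` satisfies
`|f̂(μ)|² ≤ C [ (Re μ + η − 1/2)⁻¹ ∫_{Re z = 1/2−η} (1+|z|²)^η |f̂(z)|² |dz|
  + ∫_{Re z = 1/2} |f̂(z)|² |dz| ]`. -/
theorem mellin_pointwise_eval (η : ℝ) (hη1 : 1 / 2 < η) (hη2 : η ≤ 1) :
    ∃ C > 0, ∀ f : ℝ → ℂ, ContDiff ℝ (⊤ : ℕ∞) f → HasCompactSupport f → tsupport f ⊆ Ioi 0 →
      ∀ μ : ℂ, 1 / 2 - η < μ.re → μ.re ≤ 0 →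
        ‖∫ s in Ioi (0 : ℝ), (s : ℂ) ^ (μ - 1) * f s‖ ^ 2 ≤
          C * ((μ.re + η - 1 / 2)⁻¹ *
              (∫ t : ℝ, (1 + ‖((1 / 2 - η : ℝ) : ℂ) + (t : ℂ) * Complex.I‖ ^ 2) ^ η *
                ‖∫ s in Ioi (0 : ℝ),
                    (s : ℂ) ^ ((((1 / 2 - η : ℝ) : ℂ) + (t : ℂ) * Complex.I) - 1) * f s‖ ^ 2) +
            (∫ t : ℝ,
              ‖∫ s in Ioi (0 : ℝ),
                  (s : ℂ) ^ ((((1 / 2 : ℝ) : ℂ) + (t : ℂ) * Complex.I) - 1) * f s‖ ^ 2)) := by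
  refine ⟨1, one_pos, fun f hf hc hs μ hμ₁ hμ₂ => ?_⟩
  set σ : ℝ := 1 / 2 - η with hσ
  have hδ : 0 < μ.re - σ := by linarith
  change ‖mellin f μ‖ ^ 2 ≤ 1 * ((μ.re + η - 1 / 2)⁻¹ *
    (∫ t : ℝ, (1 + ‖(σ : ℂ) + t * Complex.I‖ ^ 2) ^ η * ‖mellin f (σ + t * Complex.I)‖ ^ 2) +
    ∫ t : ℝ, ‖mellin f ((1 / 2 : ℝ) + t * Complex.I)‖ ^ 2)
  have hA := integral_norm_sq_mellin_line_le hf hc hs (by linarith) hη2 σ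
  rw [integral_norm_sq_mellin_line hf hc hs] at hA
  rw [integral_norm_sq_mellin_line hf hc hs, one_mul,
    show μ.re + η - 1 / 2 = μ.re - σ by rw [hσ]; ring]
  set A := ∫ u, ‖mellinSchwartz hf hc hs σ u‖ ^ 2
  set B := ∫ u, ‖mellinSchwartz hf hc hs (1 / 2) u‖ ^ 2
  have hA₀ : 0 ≤ A := integral_nonneg fun _ => by positivity
  have hB₀ : 0 ≤ B := integral_nonneg fun _ => by positivity
  have hneg : 2 * (σ - μ.re) < 0 := by linarith
  have hpos : 0 < 2 * (1 / 2 - μ.re) := by linarith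
  have hI := sq_setIntegral_norm_mellinSchwartz_le hf hc hs (σ := μ.re) (τ := σ)
    (integrableOn_exp_mul_Ioi hneg 0)
  have hJ := sq_setIntegral_norm_mellinSchwartz_le hf hc hs (σ := μ.re) (τ := 1 / 2)
    (integrableOn_exp_mul_Iic hpos 0)
  rw [integral_exp_mul_Ioi hneg] at hI
  rw [integral_exp_mul_Iic hpos] at hJ
  have hsplit := intervalIntegral.integral_Iic_add_Ioi (b := 0) (μ := volume)
    (mellinSchwartz hf hc hs μ.re).integrable.norm.integrableOn
    (mellinSchwartz hf hc hs μ.re).integrable.norm.integrableOn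
  have hM := norm_mellin_le hf hc hs μ
  rw [← hsplit] at hM
  set I := ∫ u in Ioi 0, ‖mellinSchwartz hf hc hs μ.re u‖
  set J := ∫ u in Iic 0, ‖mellinSchwartz hf hc hs μ.re u‖
  have hI' : 2 * I ^ 2 ≤ (μ.re - σ)⁻¹ * A := by
    calc _ ≤ 2 * (-rexp (2 * (σ - μ.re) * 0) / (2 * (σ - μ.re)) * A) := by gcongr
      _ = _ := by
        have : σ - μ.re ≠ 0 := by linarith
        rw [mul_zero, Real.exp_zero, show μ.re - σ = -(σ - μ.re) by ring]
        field_simp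
  have hJ' : J ^ 2 ≤ B := by
    refine hJ.trans (mul_le_of_le_one_left hB₀ ?_)
    rw [mul_zero, Real.exp_zero]
    exact (div_le_one hpos).2 (by linarith)
  have hAπ : A ≤ 2 * π * A := le_mul_of_one_le_left hA₀ (by linarith [Real.pi_gt_three])
  have hBπ : 2 * B ≤ 2 * π * B := by gcongr; linarith [Real.pi_gt_three]
  calc ‖mellin f μ‖ ^ 2 ≤ (J + I) ^ 2 := by gcongr
    _ ≤ 2 * I ^ 2 + 2 * J ^ 2 := by linarith [sq_nonneg (J - I)]
    _ ≤ (μ.re - σ)⁻¹ * A + 2 * B := by linarith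
    _ ≤ _ := by
      gcongr
      exact hAπ.trans hA
end

section
/- Let 1/2 < η < 1 and fix a cut-off function φ: a nonincreasing C^∞ function on [0,∞) with φ ≡ 1 on a neighborhood of 0 and φ ≡ 0 on [1,∞). There exist constants c, C > 0, depending only on η and φ, such that for every f ∈ C_c^∞([0,∞)) (the restriction to [0,∞) of a smooth compactly supported function on ℝ), c (‖f‖_{L²(0,∞)}² + |f|_{H^η}²) ≤ ∫₀^∞ |f(s) − f(0)φ(s)|² s^{−2η} ds + |f − f(0)φ|_{H^η}² + |f(0)|² + ‖f‖_{L²(0,∞)}² ≤ C (‖f‖_{L²(0,∞)}² + |f|_{H^η}²). -/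
open MeasureTheory Set

/-- The Gagliardo quotient `|h(s) - h(t)|² / |s - t|^{1+2η}` as a function on the plane. -/
noncomputable def gagliardoQuotient (η : ℝ) (h : ℝ → ℂ) (z : ℝ × ℝ) : ℝ :=
  ‖h z.1 - h z.2‖ ^ 2 / |z.1 - z.2| ^ (1 + 2 * η)

theorem gagliardoQuotient_nonneg (η : ℝ) (h : ℝ → ℂ) (z : ℝ × ℝ) :
    0 ≤ gagliardoQuotient η h z := by
  unfold gagliardoQuotient; positivity

theorem measurable_gagliardoQuotient (η : ℝ) {h : ℝ → ℂ} (hh : Continuous h) :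
    Measurable (gagliardoQuotient η h) := by
  have := hh.measurable
  unfold gagliardoQuotient
  fun_prop

theorem exists_lipschitz_Ici_of_eventually_zero {h : ℝ → ℂ} (hh : ContDiff ℝ 1 h) {R : ℝ}
    (hR : ∀ s, R ≤ s → h s = 0) :
    ∃ L, 0 ≤ L ∧ ∀ s, 0 ≤ s → ∀ t, 0 ≤ t → ‖h s - h t‖ ≤ L * |s - t| := by
  obtain ⟨L, hL⟩ := (isCompact_Icc (a := (0 : ℝ)) (b := R)).exists_bound_of_continuousOn
    (hh.continuous_deriv le_rfl).continuousOn
  have hbound : ∀ x ∈ Ici (0 : ℝ), ‖deriv h x‖ ≤ max L 0 := by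
    intro x hx
    rcases le_or_gt x R with hxR | hxR
    · exact (hL x ⟨hx, hxR⟩).trans (le_max_left _ _)
    · have : h =ᶠ[nhds x] fun _ => 0 := by
        filter_upwards [Ioi_mem_nhds hxR] with y hy using hR y (le_of_lt hy)
      rw [this.deriv_eq]
      simp
  refine ⟨max L 0, le_max_right _ _, fun s hs t ht => ?_⟩
  exact Convex.norm_image_sub_le_of_norm_deriv_le
    (fun x _ => (hh.differentiable one_ne_zero).differentiableAt) hbound (convex_Ici 0) ht hs

theorem integrable_min_sq_one_div_rpow {η : ℝ} (h0 : 0 < η) (h1 : η < 1) :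
    Integrable (fun x : ℝ => min (‖x‖ ^ 2) 1 / ‖x‖ ^ (1 + 2 * η)) := by
  rw [integrable_fun_norm_addHaar volume (f := fun x : ℝ => min (x ^ 2) 1 / x ^ (1 + 2 * η))]
  rw [← Ioc_union_Ioi_eq_Ioi (zero_le_one' ℝ)]
  refine IntegrableOn.union ?_ ?_
  · have : IntegrableOn (fun x : ℝ => x ^ (1 - 2 * η)) (Ioc 0 1) :=
      (intervalIntegrable_iff_integrableOn_Ioc_of_le zero_le_one).1
        (intervalIntegral.intervalIntegrable_rpow' (by linarith))
    refine this.congr_fun (fun x hx => ?_) measurableSet_Ioc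
    have hx0 : 0 < x := hx.1
    have : x ^ 2 ≤ 1 := by nlinarith [hx.1, hx.2]
    simp only [Module.finrank_self, min_eq_left this]
    rw [show (1 - 2 * η) = 2 - (1 + 2 * η) by ring, Real.rpow_sub hx0]
    simp
  · have : IntegrableOn (fun x : ℝ => x ^ (-(1 + 2 * η))) (Ioi 1) :=
      integrableOn_Ioi_rpow_of_lt (by linarith) one_pos
    refine this.congr_fun (fun x hx => ?_) measurableSet_Ioi
    have hx1 : 1 < x := hx
    have : 1 ≤ x ^ 2 := by nlinarith
    simp only [Module.finrank_self, min_eq_right this]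
    rw [Real.rpow_neg (by linarith)]
    simp

theorem integrable_gagliardoQuotient {η : ℝ} (h0 : 0 < η) (h1 : η < 1) {h : ℝ → ℂ}
    (hh : ContDiff ℝ 1 h) {R : ℝ} (hR : ∀ s, R ≤ s → h s = 0) :
    Integrable (gagliardoQuotient η h)
      ((volume.restrict (Ioi 0)).prod (volume.restrict (Ioi 0))) := by
  wlog hRpos : 0 < R generalizing R
  · exact this (R := 1) (fun s hs => hR s (by linarith)) one_pos
  obtain ⟨L, hL0, hL⟩ := exists_lipschitz_Ici_of_eventually_zero hh hR
  set k : ℝ → ℝ := fun x => min (‖x‖ ^ 2) 1 / ‖x‖ ^ (1 + 2 * η) with hk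
  have hkint : Integrable k := integrable_min_sq_one_div_rpow h0 h1
  have hind : Integrable ((Iio R ∩ Ioi 0).indicator (fun _ => (1 : ℝ))) :=
    (integrable_indicator_iff (measurableSet_Iio.inter measurableSet_Ioi)).2
      (integrableOn_const (by
        rw [inter_comm, Ioi_inter_Iio]; simp))
  have hconv := Integrable.convolution_integrand (ContinuousLinearMap.mul ℝ ℝ) hind hkint
  have hsum := ((hconv.add hconv.swap).const_mul (L ^ 2 * (1 + 4 * R ^ 2)))
  rw [Measure.prod_restrict]
  refine Integrable.mono' (hsum.restrict (s := Ioi 0 ×ˢ Ioi 0))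
    (measurable_gagliardoQuotient η hh.continuous).aestronglyMeasurable ?_
  filter_upwards [ae_restrict_mem (measurableSet_Ioi.prod measurableSet_Ioi)] with z hz
  obtain ⟨s, t⟩ := z
  have hs : 0 < s := hz.1
  have ht : 0 < t := hz.2
  rw [Real.norm_of_nonneg (gagliardoQuotient_nonneg _ _ _)]
  have hbd : ∀ x, 0 < x → ‖h x‖ ≤ L * R := by
    intro x hx
    rcases le_or_gt R x with hxR | hxR
    · rw [hR x hxR]; simp; positivity
    · have := hL x hx.le R hRpos.le
      rw [hR R le_rfl, sub_zero] at this
      refine this.trans (mul_le_mul_of_nonneg_left ?_ hL0)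
      rw [abs_le]; constructor <;> linarith
  have hnum : ‖h s - h t‖ ^ 2 ≤ L ^ 2 * (1 + 4 * R ^ 2) * min (‖s - t‖ ^ 2) 1 := by
    have e1 : ‖h s - h t‖ ^ 2 ≤ (L * |s - t|) ^ 2 :=
      pow_le_pow_left₀ (norm_nonneg _) (hL s hs.le t ht.le) 2
    have e2 : ‖h s - h t‖ ^ 2 ≤ (L * R + L * R) ^ 2 :=
      pow_le_pow_left₀ (norm_nonneg _)
        ((norm_sub_le _ _).trans (add_le_add (hbd s hs) (hbd t ht))) 2
    rw [Real.norm_eq_abs]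
    rcases min_cases (|s - t| ^ 2) 1 with ⟨h, -⟩ | ⟨h, -⟩ <;> rw [h]
    · refine e1.trans ?_
      have : 0 ≤ L ^ 2 * R ^ 2 * |s - t| ^ 2 := by positivity
      nlinarith
    · refine e2.trans ?_
      nlinarith [sq_nonneg L]
  have hkst : gagliardoQuotient η h (s, t) ≤ L ^ 2 * (1 + 4 * R ^ 2) * k (s - t) := by
    simp only [gagliardoQuotient, hk]
    rw [← mul_div_assoc]
    exact div_le_div_of_nonneg_right hnum (by positivity)
  have hk0 : ∀ x, 0 ≤ k x := fun x => by simp only [hk]; positivity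
  have hksymm : k (t - s) = k (s - t) := by simp only [hk, norm_sub_rev]
  have hC : 0 ≤ L ^ 2 * (1 + 4 * R ^ 2) := by positivity
  simp only [Pi.add_apply, Function.comp, Prod.swap, ContinuousLinearMap.mul_apply', hksymm]
  by_cases hs' : s < R
  · refine hkst.trans (mul_le_mul_of_nonneg_left ?_ hC)
    have : s ∈ Iio R ∩ Ioi 0 := ⟨hs', hs⟩
    simp only [indicator_of_mem this, one_mul]
    exact le_add_of_nonneg_left (mul_nonneg (indicator_nonneg (fun _ _ => zero_le_one) _) (hk0 _))
  by_cases ht' : t < R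
  · refine hkst.trans (mul_le_mul_of_nonneg_left ?_ hC)
    have : t ∈ Iio R ∩ Ioi 0 := ⟨ht', ht⟩
    simp only [indicator_of_mem this, one_mul]
    exact le_add_of_nonneg_right (mul_nonneg (indicator_nonneg (fun _ _ => zero_le_one) _) (hk0 _))
  · simp only [gagliardoQuotient, hR s (not_lt.1 hs'), hR t (not_lt.1 ht')]
    simp
    have := hk0 (s - t)
    refine mul_nonneg hC (add_nonneg ?_ ?_) <;>
    exact (mul_nonneg (indicator_nonneg (fun _ _ => zero_le_one) _) (hk0 _))

theorem integrableOn_sq_mul_rpow {η : ℝ} (h1 : η < 1) {h : ℝ → ℂ} (hh : Continuous h) {L : ℝ}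
    (hL : ∀ s, 0 < s → ‖h s‖ ≤ L * s) :
    IntegrableOn (fun s : ℝ => ‖h s‖ ^ 2 * s ^ (-(2 * η))) (Ioc 0 1) := by
  have hmeas : Measurable fun s : ℝ => ‖h s‖ ^ 2 * s ^ (-(2 * η)) := by
    have := hh.measurable
    fun_prop
  refine Integrable.mono' (g := fun _ => L ^ 2) (integrableOn_const (by simp))
    hmeas.aestronglyMeasurable ?_
  filter_upwards [ae_restrict_mem measurableSet_Ioc] with s hs
  have hs0 : 0 < s := hs.1
  rw [Real.norm_of_nonneg (by positivity)]
  calc ‖h s‖ ^ 2 * s ^ (-(2 * η)) ≤ (L * s) ^ 2 * s ^ (-(2 * η)) := by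
        have := hL s hs0
        gcongr
    _ = L ^ 2 * s ^ (2 - 2 * η) := by
        rw [mul_pow, mul_assoc, sub_eq_add_neg, Real.rpow_add hs0]
        simp
    _ ≤ L ^ 2 * 1 := by
        gcongr
        exact Real.rpow_le_one hs0.le hs.2 (by linarith)
    _ = L ^ 2 := mul_one _

theorem norm_sq_mul_rpow_le_add_gagliardoQuotient {η : ℝ} (h0 : 1 / 2 < η) (h : ℝ → ℂ) {s u : ℝ}
    (hu : 0 < u) (hus : u < s) :
    ‖h s‖ ^ 2 * s ^ (-(2 * η) - 1) ≤ (η + 1 / 2) * ‖h u‖ ^ 2 * s ^ (-(2 * η) - 1) +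
      (η + 1 / 2) / (η - 1 / 2) * gagliardoQuotient η h (s, u) := by
  have hε : 0 < η - 1 / 2 := by linarith
  have hs : 0 < s := hu.trans hus
  have hsq : ‖h s‖ ^ 2 ≤ (η + 1 / 2) * ‖h u‖ ^ 2 +
      (η + 1 / 2) / (η - 1 / 2) * ‖h s - h u‖ ^ 2 := by
    have htri : ‖h s‖ ≤ ‖h u‖ + ‖h s - h u‖ := by
      simpa using norm_add_le (h u) (h s - h u)
    have h2 : ‖h s‖ ^ 2 ≤ (‖h u‖ + ‖h s - h u‖) ^ 2 := pow_le_pow_left₀ (norm_nonneg _) htri 2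
    refine h2.trans ?_
    generalize ‖h u‖ = a
    generalize ‖h s - h u‖ = b
    have key : (η + 1 / 2) * a ^ 2 + (η + 1 / 2) / (η - 1 / 2) * b ^ 2 - (a + b) ^ 2 =
        ((η - 1 / 2) * a - b) ^ 2 / (η - 1 / 2) := by
      obtain ⟨e, rfl⟩ : ∃ e, η = e + 1 / 2 := ⟨η - 1 / 2, by ring⟩
      simp only [add_sub_cancel_right] at hε ⊢
      field_simp
      ring
    have : 0 ≤ ((η - 1 / 2) * a - b) ^ 2 / (η - 1 / 2) := by positivity
    linarith
  have hk : ‖h s - h u‖ ^ 2 * s ^ (-(2 * η) - 1) ≤ gagliardoQuotient η h (s, u) := by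
    simp only [gagliardoQuotient]
    rw [abs_of_pos (sub_pos.2 hus), show -(2 * η) - 1 = -(1 + 2 * η) by ring,
      Real.rpow_neg hs.le, ← div_eq_mul_inv]
    have : 0 < s - u := sub_pos.2 hus
    gcongr
    linarith
  calc ‖h s‖ ^ 2 * s ^ (-(2 * η) - 1)
      ≤ ((η + 1 / 2) * ‖h u‖ ^ 2 + (η + 1 / 2) / (η - 1 / 2) * ‖h s - h u‖ ^ 2) *
          s ^ (-(2 * η) - 1) := by gcongr
    _ = (η + 1 / 2) * ‖h u‖ ^ 2 * s ^ (-(2 * η) - 1) +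
          (η + 1 / 2) / (η - 1 / 2) * (‖h s - h u‖ ^ 2 * s ^ (-(2 * η) - 1)) := by ring
    _ ≤ _ := by gcongr

theorem lintegral_Ioi_two_mul_rpow_le {η : ℝ} (h0 : 1 / 2 < η) {A u : ℝ} (hA : 0 ≤ A)
    (hu : 0 < u) :
    ∫⁻ s in Ioi (2 * u), ENNReal.ofReal ((η + 1 / 2) * A * s ^ (-(2 * η) - 1)) ≤
      ENNReal.ofReal ((1 / 4 + 1 / (8 * η)) * (A * u ^ (-(2 * η)))) := by
  have h2u : 0 < 2 * u := by positivity
  have hη : 0 < η := by linarith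
  rw [← ofReal_integral_eq_lintegral_ofReal
    ((integrableOn_Ioi_rpow_of_lt (by linarith) h2u).const_mul _)
    (by
      filter_upwards [ae_restrict_mem measurableSet_Ioi] with s hs
      have : 0 < s := h2u.trans hs
      simp only [Pi.zero_apply]
      positivity)]
  refine ENNReal.ofReal_le_ofReal ?_
  rw [integral_const_mul, integral_Ioi_rpow_of_lt (by linarith) h2u]
  have e : (2 * u) ^ (-(2 * η)) ≤ 1 / 2 * u ^ (-(2 * η)) := by
    rw [Real.mul_rpow zero_le_two hu.le]
    gcongr
    calc (2 : ℝ) ^ (-(2 * η)) ≤ 2 ^ (-1 : ℝ) :=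
          Real.rpow_le_rpow_of_exponent_le one_le_two (by linarith)
      _ = 1 / 2 := by rw [Real.rpow_neg_one]; norm_num
  calc (η + 1 / 2) * A * (-(2 * u) ^ (-(2 * η) - 1 + 1) / (-(2 * η) - 1 + 1))
      = (η + 1 / 2) * A * ((2 * u) ^ (-(2 * η)) / (2 * η)) := by
        rw [show -(2 * η) - 1 + 1 = -(2 * η) by ring, neg_div_neg_eq]
    _ ≤ (η + 1 / 2) * A * (1 / 2 * u ^ (-(2 * η)) / (2 * η)) := by gcongr
    _ = _ := by
        field_simp
        ring

/-- Fractional Hardy inequality near the origin for functions vanishing at `0`. -/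
theorem setIntegral_Ioc_sq_mul_rpow_le {η : ℝ} (h0 : 1 / 2 < η) (h1 : η < 1) {h : ℝ → ℂ}
    (hh : Continuous h) {L : ℝ} (hL : ∀ s, 0 < s → ‖h s‖ ≤ L * s)
    (hQ : Integrable (gagliardoQuotient η h)
      ((volume.restrict (Ioi 0)).prod (volume.restrict (Ioi 0)))) :
    ∫ s in Ioc (0 : ℝ) 1, ‖h s‖ ^ 2 * s ^ (-(2 * η)) ≤
      (η + 1 / 2) / (η - 1 / 2) / (1 / 4 - 1 / (8 * η)) *
        ∫ s in Ioi (0 : ℝ), ∫ t in Ioi (0 : ℝ), gagliardoQuotient η h (s, t) := by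
  set D := (η + 1 / 2) / (η - 1 / 2) with hD
  have hη : 0 < η := by linarith
  have hD0 : 0 < D := div_pos (by linarith) (by linarith)
  have hm := hh.measurable
  have hint := integrableOn_sq_mul_rpow h1 hh hL
  have hH := ofReal_integral_eq_lintegral_ofReal hint (by
    filter_upwards [ae_restrict_mem measurableSet_Ioc] with s hs
    have : 0 < s := hs.1
    simp only [Pi.zero_apply]
    positivity)
  have hH0 : 0 ≤ ∫ s in Ioc (0 : ℝ) 1, ‖h s‖ ^ 2 * s ^ (-(2 * η)) :=
    setIntegral_nonneg measurableSet_Ioc fun s hs => by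
      have : 0 < s := hs.1
      positivity
  have hE := ofReal_integral_eq_lintegral_ofReal (hQ.const_mul D)
    (Filter.Eventually.of_forall fun z => mul_nonneg hD0.le (gagliardoQuotient_nonneg η h z))
  have hQm := measurable_gagliardoQuotient η hh
  rw [lintegral_prod _ (by fun_prop), integral_const_mul, integral_prod _ hQ] at hE
  have hE0 : 0 ≤ ∫ s in Ioi (0 : ℝ), ∫ t in Ioi (0 : ℝ), gagliardoQuotient η h (s, t) :=
    integral_nonneg fun s => integral_nonneg fun t => gagliardoQuotient_nonneg η h _
  set H := ∫ s in Ioc (0 : ℝ) 1, ‖h s‖ ^ 2 * s ^ (-(2 * η))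
  set E := ∫ s in Ioi (0 : ℝ), ∫ t in Ioi (0 : ℝ), gagliardoQuotient η h (s, t)
  set F : ℝ → ℝ → ENNReal := fun s u => {p : ℝ × ℝ | 2 * p.2 < p.1}.indicator
    (fun p => ENNReal.ofReal ((η + 1 / 2) * ‖h p.2‖ ^ 2 * p.1 ^ (-(2 * η) - 1))) (s, u) with hF
  have hset : MeasurableSet {p : ℝ × ℝ | 2 * p.2 < p.1} :=
    measurableSet_lt (by fun_prop) (by fun_prop)
  have hFm : Measurable (Function.uncurry F) :=
    Measurable.indicator (by fun_prop) hset
  have step1 : ∀ s ∈ Ioc (0 : ℝ) 1,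
      ENNReal.ofReal (1 / 2) * ENNReal.ofReal (‖h s‖ ^ 2 * s ^ (-(2 * η))) ≤
        (∫⁻ u in Ioi 0, F s u) +
          ∫⁻ u in Ioi 0, ENNReal.ofReal (D * gagliardoQuotient η h (s, u)) := by
    intro s hs
    have hs0 : 0 < s := hs.1
    rw [← lintegral_add_right _ (by fun_prop)]
    calc ENNReal.ofReal (1 / 2) * ENNReal.ofReal (‖h s‖ ^ 2 * s ^ (-(2 * η)))
        = ∫⁻ u in Ioo 0 (s / 2), ENNReal.ofReal (‖h s‖ ^ 2 * s ^ (-(2 * η) - 1)) := by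
          rw [setLIntegral_const, Real.volume_Ioo, ← ENNReal.ofReal_mul (by norm_num),
            ← ENNReal.ofReal_mul (by positivity), Real.rpow_sub_one hs0.ne']
          congr 1
          field_simp
          ring
      _ ≤ ∫⁻ u in Ioo 0 (s / 2),
            (F s u + ENNReal.ofReal (D * gagliardoQuotient η h (s, u))) := by
          refine setLIntegral_mono' measurableSet_Ioo fun u hu => ?_
          have hmem : (s, u) ∈ {p : ℝ × ℝ | 2 * p.2 < p.1} := by
            have := hu.2
            simp only [mem_ofPred_eq]
            linarith
          have hu0 : 0 < u := hu.1
          simp only [hF, indicator_of_mem hmem]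
          rw [← ENNReal.ofReal_add (by positivity)
            (mul_nonneg hD0.le (gagliardoQuotient_nonneg _ _ _))]
          exact ENNReal.ofReal_le_ofReal
            (norm_sq_mul_rpow_le_add_gagliardoQuotient h0 h hu0 (by linarith [hu.2]))
      _ ≤ _ := lintegral_mono_set Ioo_subset_Ioi_self
  have step2 : ∫⁻ s in Ioc 0 1, ∫⁻ u in Ioi 0, F s u ≤
      ENNReal.ofReal ((1 / 4 + 1 / (8 * η)) * H) := by
    rw [lintegral_lintegral_swap hFm.aemeasurable, ENNReal.ofReal_mul (by positivity), hH,
      ← lintegral_const_mul _ (by fun_prop)]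
    have hle : ∀ u ∈ Ioi (0 : ℝ), ∫⁻ s in Ioc 0 1, F s u ≤ (Ioc (0 : ℝ) 1).indicator
        (fun u => ENNReal.ofReal (1 / 4 + 1 / (8 * η)) *
          ENNReal.ofReal (‖h u‖ ^ 2 * u ^ (-(2 * η)))) u := by
      intro u hu
      have hu0 : 0 < u := hu
      rcases le_or_gt u 1 with hu1 | hu1
      · rw [indicator_of_mem (show u ∈ Ioc 0 1 from ⟨hu0, hu1⟩),
          ← ENNReal.ofReal_mul (by positivity)]
        refine le_trans ?_ (lintegral_Ioi_two_mul_rpow_le h0 (sq_nonneg ‖h u‖) hu0)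
        rw [← lintegral_indicator measurableSet_Ioi]
        refine (setLIntegral_le_lintegral _ _).trans (lintegral_mono fun s => ?_)
        simp only [hF, indicator, mem_ofPred_eq, mem_Ioi]
        exact le_rfl
      · refine le_of_eq_of_le ?_ zero_le
        rw [setLIntegral_congr_fun (g := fun _ => 0) measurableSet_Ioc, lintegral_zero]
        intro s hs
        have hs1 : s ≤ 1 := hs.2
        refine indicator_of_notMem (fun hmem => ?_) _
        simp only [mem_ofPred_eq] at hmem
        linarith
    refine (setLIntegral_mono' measurableSet_Ioi hle).trans ?_
    refine (setLIntegral_le_lintegral _ _).trans ?_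
    rw [lintegral_indicator measurableSet_Ioc]
  have key : ENNReal.ofReal (1 / 2 * H) ≤
      ENNReal.ofReal ((1 / 4 + 1 / (8 * η)) * H + D * E) := by
    rw [ENNReal.ofReal_mul (by norm_num), ENNReal.ofReal_add (by positivity) (by positivity), hE,
      hH, ← lintegral_const_mul _ (by fun_prop)]
    refine (setLIntegral_mono' measurableSet_Ioc step1).trans ?_
    have hFm' : Measurable fun s => ∫⁻ u in Ioi 0, F s u := hFm.lintegral_prod_right'
    rw [lintegral_add_left hFm']
    exact add_le_add step2 (lintegral_mono_set Ioc_subset_Ioi_self)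
  rw [ENNReal.ofReal_le_ofReal_iff (by positivity)] at key
  have hκ : 0 < 1 / 4 - 1 / (8 * η) := by
    rw [sub_pos, div_lt_div_iff₀ (by positivity) (by positivity)]
    linarith
  rw [div_mul_eq_mul_div, le_div_iff₀ hκ]
  linarith

theorem gagliardoQuotient_add_mul_le (η : ℝ) {h g ψ : ℝ → ℂ} {a : ℂ}
    (hg : ∀ s, h s = g s + a * ψ s) (z : ℝ × ℝ) :
    gagliardoQuotient η h z ≤
      2 * gagliardoQuotient η g z + 2 * ‖a‖ ^ 2 * gagliardoQuotient η ψ z := by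
  simp only [gagliardoQuotient, hg]
  rw [← mul_div_assoc, ← mul_div_assoc, ← add_div]
  refine div_le_div_of_nonneg_right ?_ (by positivity)
  have e : g z.1 + a * ψ z.1 - (g z.2 + a * ψ z.2) =
      (g z.1 - g z.2) + a * (ψ z.1 - ψ z.2) := by ring
  have htri := norm_add_le (g z.1 - g z.2) (a * (ψ z.1 - ψ z.2))
  rw [norm_mul] at htri
  rw [e]
  have h2 := pow_le_pow_left₀ (norm_nonneg _) htri 2
  nlinarith [sq_nonneg (‖g z.1 - g z.2‖ - ‖a‖ * ‖ψ z.1 - ψ z.2‖)]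

theorem integral_gagliardoQuotient_add_mul_le {η : ℝ} {h g ψ : ℝ → ℂ} {a : ℂ}
    (hg : ∀ s, h s = g s + a * ψ s)
    (hQh : Integrable (gagliardoQuotient η h)
      ((volume.restrict (Ioi 0)).prod (volume.restrict (Ioi 0))))
    (hQg : Integrable (gagliardoQuotient η g)
      ((volume.restrict (Ioi 0)).prod (volume.restrict (Ioi 0))))
    (hQψ : Integrable (gagliardoQuotient η ψ)
      ((volume.restrict (Ioi 0)).prod (volume.restrict (Ioi 0)))) :
    ∫ s in Ioi (0 : ℝ), ∫ t in Ioi (0 : ℝ), gagliardoQuotient η h (s, t) ≤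
      2 * (∫ s in Ioi (0 : ℝ), ∫ t in Ioi (0 : ℝ), gagliardoQuotient η g (s, t)) +
        2 * ‖a‖ ^ 2 * ∫ s in Ioi (0 : ℝ), ∫ t in Ioi (0 : ℝ), gagliardoQuotient η ψ (s, t) := by
  rw [← integral_prod _ hQh, ← integral_prod _ hQg, ← integral_prod _ hQψ,
    ← integral_const_mul, ← integral_const_mul,
    ← integral_add (hQg.const_mul _) (hQψ.const_mul _)]
  exact integral_mono hQh ((hQg.const_mul _).add (hQψ.const_mul _))
    (gagliardoQuotient_add_mul_le η hg)

/-- Trace inequality obtained from weighted control of `f - f 0` near the origin. -/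
theorem norm_sq_apply_zero_le {η : ℝ} (h0 : 0 < η) {f : ℝ → ℂ}
    (hf : IntegrableOn (fun s => ‖f s‖ ^ 2) (Ioi 0))
    (hw : IntegrableOn (fun s : ℝ => ‖f s - f 0‖ ^ 2 * s ^ (-(2 * η))) (Ioc 0 1)) :
    ‖f 0‖ ^ 2 ≤ 2 * (∫ s in Ioi (0 : ℝ), ‖f s‖ ^ 2) +
      2 * ∫ s in Ioc (0 : ℝ) 1, ‖f s - f 0‖ ^ 2 * s ^ (-(2 * η)) := by
  have hf' := hf.mono_set (Ioc_subset_Ioi_self (a := (1 : ℝ)) (b := 0))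
  have hmono : ∫ s in Ioc (0 : ℝ) 1, ‖f s‖ ^ 2 ≤ ∫ s in Ioi (0 : ℝ), ‖f s‖ ^ 2 :=
    setIntegral_mono_set hf (Filter.Eventually.of_forall fun s => by positivity)
      Ioc_subset_Ioi_self.eventuallyLE
  calc ‖f 0‖ ^ 2 = ∫ s in Ioc (0 : ℝ) 1, ‖f 0‖ ^ 2 := by simp
    _ ≤ ∫ s in Ioc (0 : ℝ) 1,
          (2 * ‖f s‖ ^ 2 + 2 * (‖f s - f 0‖ ^ 2 * s ^ (-(2 * η)))) := by
        refine setIntegral_mono_on (integrableOn_const (by simp))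
          ((hf'.const_mul 2).add (hw.const_mul 2)) measurableSet_Ioc fun s hs => ?_
        have hs1 : 1 ≤ s ^ (-(2 * η)) :=
          Real.one_le_rpow_of_pos_of_le_one_of_nonpos hs.1 hs.2 (by linarith)
        have hle : ‖f s - f 0‖ ^ 2 ≤ ‖f s - f 0‖ ^ 2 * s ^ (-(2 * η)) :=
          le_mul_of_one_le_right (by positivity) hs1
        have htri : ‖f 0‖ ≤ ‖f s‖ + ‖f s - f 0‖ := by
          simpa using norm_sub_le (f s) (f s - f 0)
        nlinarith [pow_le_pow_left₀ (norm_nonneg _) htri 2, sq_nonneg (‖f s‖ - ‖f s - f 0‖)]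
    _ = 2 * (∫ s in Ioc (0 : ℝ) 1, ‖f s‖ ^ 2) +
          2 * ∫ s in Ioc (0 : ℝ) 1, ‖f s - f 0‖ ^ 2 * s ^ (-(2 * η)) := by
        rw [integral_add (hf'.const_mul 2) (hw.const_mul 2), integral_const_mul,
          integral_const_mul]
    _ ≤ _ := by gcongr

theorem setIntegral_Ioi_sq_mul_rpow_le {η : ℝ} (h0 : 0 < η) {f g : ℝ → ℂ}
    (hg : Continuous g) (hfg : ∀ s, 1 ≤ s → g s = f s)
    (hf : IntegrableOn (fun s => ‖f s‖ ^ 2) (Ioi 0))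
    (hw : IntegrableOn (fun s : ℝ => ‖g s‖ ^ 2 * s ^ (-(2 * η))) (Ioc 0 1)) :
    ∫ s in Ioi (0 : ℝ), ‖g s‖ ^ 2 * s ^ (-(2 * η)) ≤
      (∫ s in Ioc (0 : ℝ) 1, ‖g s‖ ^ 2 * s ^ (-(2 * η))) + ∫ s in Ioi (0 : ℝ), ‖f s‖ ^ 2 := by
  have hsub : Ioi (1 : ℝ) ⊆ Ioi 0 := Ioi_subset_Ioi zero_le_one
  have hf' := hf.mono_set hsub
  have hle : ∀ s ∈ Ioi (1 : ℝ), ‖g s‖ ^ 2 * s ^ (-(2 * η)) ≤ ‖f s‖ ^ 2 := fun s hs => by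
    have hs1 : 1 < s := hs
    rw [hfg s hs1.le]
    exact mul_le_of_le_one_right (by positivity)
      (Real.rpow_le_one_of_one_le_of_nonpos hs1.le (by linarith))
  have hint : IntegrableOn (fun s : ℝ => ‖g s‖ ^ 2 * s ^ (-(2 * η))) (Ioi 1) := by
    have hm : Measurable fun s : ℝ => ‖g s‖ ^ 2 * s ^ (-(2 * η)) := by
      have := hg.measurable
      fun_prop
    refine Integrable.mono' hf' hm.aestronglyMeasurable ?_
    filter_upwards [ae_restrict_mem measurableSet_Ioi] with s hs
    have hs0 : 0 < s := hsub hs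
    rw [Real.norm_of_nonneg (by positivity)]
    exact hle s hs
  rw [← Ioc_union_Ioi_eq_Ioi (zero_le_one' ℝ),
    setIntegral_union (Ioc_disjoint_Ioi le_rfl) measurableSet_Ioi hw hint,
    Ioc_union_Ioi_eq_Ioi (zero_le_one' ℝ)]
  gcongr
  exact (setIntegral_mono_on hint hf' measurableSet_Ioi hle).trans
    (setIntegral_mono_set hf (Filter.Eventually.of_forall fun s => by positivity)
      hsub.eventuallyLE)

/-- Lemma 2.4, case `1/2 < η < 1`: the `H^η(0,∞)` norm of
`f ∈ C_c^∞([0,∞))` is equivalent to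
`‖f − f(0)φ‖_{W₀^η}² + |f(0)|² + ‖f‖_{L²}²`, where `φ` is a fixed cut-off function. -/
theorem sobolev_norm_equivalence (η : ℝ) (hη1 : 1 / 2 < η) (hη2 : η < 1)
    (φ : ℝ → ℝ) (hφsmooth : ContDiff ℝ (⊤ : ℕ∞) φ) (hφmono : AntitoneOn φ (Ici 0))
    (hφone : ∃ δ > 0, ∀ s ∈ Icc (0 : ℝ) δ, φ s = 1)
    (hφzero : ∀ s : ℝ, 1 ≤ s → φ s = 0) :
    ∃ c > 0, ∃ C > 0, ∀ f : ℝ → ℂ, ContDiff ℝ (⊤ : ℕ∞) f → HasCompactSupport f →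
      c * ((∫ s in Ioi (0 : ℝ), ‖f s‖ ^ 2) +
            (∫ s in Ioi (0 : ℝ), ∫ t in Ioi (0 : ℝ), ‖f s - f t‖ ^ 2 / |s - t| ^ (1 + 2 * η)))
        ≤ (∫ s in Ioi (0 : ℝ), ‖f s - f 0 * (φ s : ℂ)‖ ^ 2 * s ^ (-(2 * η))) +
          (∫ s in Ioi (0 : ℝ), ∫ t in Ioi (0 : ℝ),
            ‖(f s - f 0 * (φ s : ℂ)) - (f t - f 0 * (φ t : ℂ))‖ ^ 2 / |s - t| ^ (1 + 2 * η)) +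
          ‖f 0‖ ^ 2 + (∫ s in Ioi (0 : ℝ), ‖f s‖ ^ 2) ∧
      (∫ s in Ioi (0 : ℝ), ‖f s - f 0 * (φ s : ℂ)‖ ^ 2 * s ^ (-(2 * η))) +
          (∫ s in Ioi (0 : ℝ), ∫ t in Ioi (0 : ℝ),
            ‖(f s - f 0 * (φ s : ℂ)) - (f t - f 0 * (φ t : ℂ))‖ ^ 2 / |s - t| ^ (1 + 2 * η)) +
          ‖f 0‖ ^ 2 + (∫ s in Ioi (0 : ℝ), ‖f s‖ ^ 2)
        ≤ C * ((∫ s in Ioi (0 : ℝ), ‖f s‖ ^ 2) +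
            (∫ s in Ioi (0 : ℝ), ∫ t in Ioi (0 : ℝ),
              ‖f s - f t‖ ^ 2 / |s - t| ^ (1 + 2 * η))) := by
  have hη0 : 0 < η := by linarith
  set ψ : ℝ → ℂ := fun s => (φ s : ℂ) with hψ
  have hψsmooth : ContDiff ℝ 1 ψ :=
    Complex.ofRealCLM.contDiff.comp (hφsmooth.of_le (by exact_mod_cast le_top))
  have hψzero : ∀ s, 1 ≤ s → ψ s = 0 := fun s hs => by simp [hψ, hφzero s hs]
  have hψ0 : ψ 0 = 1 := by
    obtain ⟨δ, hδ, h⟩ := hφone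
    simp [hψ, h 0 ⟨le_rfl, hδ.le⟩]
  have hQψ := integrable_gagliardoQuotient hη0 hη2 hψsmooth hψzero
  set A := ∫ s in Ioi (0 : ℝ), ∫ t in Ioi (0 : ℝ), gagliardoQuotient η ψ (s, t)
  have hA : 0 ≤ A :=
    integral_nonneg fun s => integral_nonneg fun t => gagliardoQuotient_nonneg η ψ _
  set B := (η + 1 / 2) / (η - 1 / 2) / (1 / 4 - 1 / (8 * η)) with hBdef
  have hB : 0 ≤ B := by
    have hκ : 0 < 1 / 4 - 1 / (8 * η) := by
      rw [sub_pos, div_lt_div_iff₀ (by positivity) (by positivity)]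
      linarith
    have : 0 < η - 1 / 2 := by linarith
    positivity
  refine ⟨1 / (2 + 2 * A), by positivity,
    2 * (B + 1) + (2 * A * (B + 1) + 1) * (2 + 2 * B) + 2, by positivity, fun f hf hfc => ?_⟩
  have hf1 : ContDiff ℝ 1 f := hf.of_le (by exact_mod_cast le_top)
  obtain ⟨R, hR1, hR⟩ : ∃ R, 1 ≤ R ∧ ∀ s, R ≤ s → f s = 0 := by
    obtain ⟨r, hr⟩ := hfc.isCompact.isBounded.subset_closedBall 0
    refine ⟨max 1 (r + 1), le_max_left _ _, fun s hs =>
      image_eq_zero_of_notMem_tsupport fun hmem => ?_⟩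
    have h1 := mem_closedBall_zero_iff.1 (hr hmem)
    have h2 := (le_max_right 1 (r + 1)).trans hs
    have h3 := Real.le_norm_self s
    linarith
  set g : ℝ → ℂ := fun s => f s - f 0 * ψ s with hg
  have hg1 : ContDiff ℝ 1 g := hf1.sub (contDiff_const.mul hψsmooth)
  have hgR : ∀ s, R ≤ s → g s = 0 := fun s hs => by
    simp [hg, hR s hs, hψzero s (hR1.trans hs)]
  have hQf := integrable_gagliardoQuotient hη0 hη2 hf1 hR
  have hQg := integrable_gagliardoQuotient hη0 hη2 hg1 hgR
  have hN : IntegrableOn (fun s => ‖f s‖ ^ 2) (Ioi 0) :=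
    (Continuous.integrable_of_hasCompactSupport (by have := hf1.continuous; fun_prop)
      (hfc.comp_left (g := fun z : ℂ => ‖z‖ ^ 2) (by simp))).integrableOn
  have hfψ : ∀ s, f s = g s + f 0 * ψ s := fun s => by simp [hg]
  have hgψ : ∀ s, g s = f s + -f 0 * ψ s := fun s => by simp [hg, sub_eq_add_neg]
  have hfg := integral_gagliardoQuotient_add_mul_le hfψ hQf hQg hQψ
  have hgf := integral_gagliardoQuotient_add_mul_le hgψ hQg hQf hQψ
  rw [norm_neg] at hgf
  obtain ⟨Lf, -, hLf⟩ := exists_lipschitz_Ici_of_eventually_zero hf1 hR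
  obtain ⟨Lg, -, hLg⟩ := exists_lipschitz_Ici_of_eventually_zero hg1 hgR
  have hLf' : ∀ s, 0 < s → ‖f s - f 0‖ ≤ Lf * s := fun s hs => by
    simpa [abs_of_pos hs] using hLf s hs.le 0 le_rfl
  have hg0 : g 0 = 0 := by simp [hg, hψ0]
  have hLg' : ∀ s, 0 < s → ‖g s‖ ≤ Lg * s := fun s hs => by
    simpa [abs_of_pos hs, hg0] using hLg s hs.le 0 le_rfl
  have hQf0 : gagliardoQuotient η (fun s => f s - f 0) = gagliardoQuotient η f := by
    ext z
    simp [gagliardoQuotient]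
  have hf0c : Continuous fun s => f s - f 0 := hf1.continuous.sub continuous_const
  have hardyf := setIntegral_Ioc_sq_mul_rpow_le hη1 hη2 hf0c hLf' (hQf0 ▸ hQf)
  have hardyg := setIntegral_Ioc_sq_mul_rpow_le hη1 hη2 hg1.continuous hLg' hQg
  rw [hQf0] at hardyf
  have htrace := norm_sq_apply_zero_le hη0 hN (integrableOn_sq_mul_rpow hη2 hf0c hLf')
  have hH := setIntegral_Ioi_sq_mul_rpow_le (f := f) hη0 hg1.continuous
    (fun s hs => by simp [hg, hψzero s hs]) hN
    (integrableOn_sq_mul_rpow hη2 hg1.continuous hLg')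
  have hH0 : 0 ≤ ∫ s in Ioi (0 : ℝ), ‖g s‖ ^ 2 * s ^ (-(2 * η)) :=
    setIntegral_nonneg measurableSet_Ioi fun s hs => by
      have : 0 < s := hs
      positivity
  have hN0 : 0 ≤ ∫ s in Ioi (0 : ℝ), ‖f s‖ ^ 2 := integral_nonneg fun s => by positivity
  have hGf0 : 0 ≤ ∫ s in Ioi (0 : ℝ), ∫ t in Ioi (0 : ℝ), gagliardoQuotient η f (s, t) :=
    integral_nonneg fun s => integral_nonneg fun t => gagliardoQuotient_nonneg η f _
  have hGg0 : 0 ≤ ∫ s in Ioi (0 : ℝ), ∫ t in Ioi (0 : ℝ), gagliardoQuotient η g (s, t) :=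
    integral_nonneg fun s => integral_nonneg fun t => gagliardoQuotient_nonneg η g _
  rw [← hBdef] at hardyf hardyg
  have hp : 0 ≤ ‖f 0‖ ^ 2 := by positivity
  change 1 / (2 + 2 * A) * ((∫ s in Ioi (0 : ℝ), ‖f s‖ ^ 2) +
      ∫ s in Ioi (0 : ℝ), ∫ t in Ioi (0 : ℝ), gagliardoQuotient η f (s, t)) ≤
      (∫ s in Ioi (0 : ℝ), ‖g s‖ ^ 2 * s ^ (-(2 * η))) +
        (∫ s in Ioi (0 : ℝ), ∫ t in Ioi (0 : ℝ), gagliardoQuotient η g (s, t)) +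
        ‖f 0‖ ^ 2 + (∫ s in Ioi (0 : ℝ), ‖f s‖ ^ 2) ∧
    (∫ s in Ioi (0 : ℝ), ‖g s‖ ^ 2 * s ^ (-(2 * η))) +
        (∫ s in Ioi (0 : ℝ), ∫ t in Ioi (0 : ℝ), gagliardoQuotient η g (s, t)) +
        ‖f 0‖ ^ 2 + (∫ s in Ioi (0 : ℝ), ‖f s‖ ^ 2) ≤ _ * ((∫ s in Ioi (0 : ℝ), ‖f s‖ ^ 2) +
      ∫ s in Ioi (0 : ℝ), ∫ t in Ioi (0 : ℝ), gagliardoQuotient η f (s, t))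
  generalize (∫ s in Ioi (0 : ℝ), ∫ t in Ioi (0 : ℝ), gagliardoQuotient η f (s, t)) = Gf at *
  generalize (∫ s in Ioi (0 : ℝ), ∫ t in Ioi (0 : ℝ), gagliardoQuotient η g (s, t)) = Gg at *
  generalize (∫ s in Ioi (0 : ℝ), ‖f s‖ ^ 2) = N at *
  generalize (∫ s in Ioi (0 : ℝ), ‖g s‖ ^ 2 * s ^ (-(2 * η))) = H at *
  generalize ‖f 0‖ ^ 2 = p at *
  constructor
  · rw [div_mul_eq_mul_div, one_mul, div_le_iff₀ (by positivity)]
    have : 0 ≤ 2 * A * (H + Gg + N) + 2 * H + N + 2 * p := by positivity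
    linarith
  · have hp' : p ≤ (2 + 2 * B) * (N + Gf) := by
      have : 0 ≤ B * N := by positivity
      linarith
    have hBG : B * Gg ≤ B * (2 * Gf + 2 * p * A) := mul_le_mul_of_nonneg_left hgf hB
    have hAp := mul_le_mul_of_nonneg_left hp' (show 0 ≤ 2 * A * (B + 1) + 1 by positivity)
    have : 0 ≤ 2 * (B + 1) * N + 2 * Gf := by positivity
    linarith
end

section
/- Fix a cut-off function φ: a nonincreasing C^∞ function on [0,∞) with φ ≡ 1 on a neighborhood of 0 and φ ≡ 0 on [1,∞). There is a constant C > 0, depending only on φ, such that for every f ∈ C_c^∞([0,∞)) (the restriction to [0,∞) of a smooth compactly supported function on ℝ), setting g = f − f(0)φ, one has ∫₀^∞ |g(s)|² s^{−1} ds + ∫₀^∞ ∫₀^∞ |g(s) − g(t)|²/|s − t|² ds dt ≤ C (‖f‖_{L²(0,∞)}² + ‖f'‖_{L²(0,∞)}²). -/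
open MeasureTheory Set

theorem enorm_add_sq_le_two_mul {E : Type*} [NormedAddCommGroup E] (x y : E) :
    ‖x + y‖ₑ ^ 2 ≤ 2 * (‖x‖ₑ ^ 2 + ‖y‖ₑ ^ 2) := by
  have h : ‖x + y‖₊ ^ 2 ≤ 2 * (‖x‖₊ ^ 2 + ‖y‖₊ ^ 2) :=
    (pow_le_pow_left₀ zero_le (nnnorm_add_le x y) 2).trans add_sq_le
  simp only [enorm_eq_nnnorm]
  exact_mod_cast h

theorem enorm_sub_sq_le_two_mul {E : Type*} [NormedAddCommGroup E] (x y : E) :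
    ‖x - y‖ₑ ^ 2 ≤ 2 * (‖x‖ₑ ^ 2 + ‖y‖ₑ ^ 2) := by
  simpa [sub_eq_add_neg] using enorm_add_sq_le_two_mul x (-y)

theorem lintegral_sq_le_measure_mul {α : Type*} [MeasurableSpace α] {μ : Measure α}
    {f : α → ENNReal} (hf : AEMeasurable f μ) :
    (∫⁻ x, f x ∂μ) ^ 2 ≤ μ univ * ∫⁻ x, f x ^ 2 ∂μ := by
  have h := ENNReal.lintegral_mul_le_Lp_mul_Lq μ Real.HolderConjugate.two_two
    (f := fun _ ↦ 1) (g := f) aemeasurable_const hf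
  have hroot (x : ENNReal) : (x ^ (1 / 2 : ℝ)) ^ 2 = x := by
    rw [← ENNReal.rpow_natCast, ← ENNReal.rpow_mul]
    norm_num
  calc (∫⁻ x, f x ∂μ) ^ 2
      ≤ ((μ univ) ^ (1 / 2 : ℝ) * (∫⁻ x, f x ^ 2 ∂μ) ^ (1 / 2 : ℝ)) ^ 2 := by
        gcongr
        simpa using h
    _ = μ univ * ∫⁻ x, f x ^ 2 ∂μ := by rw [mul_pow, hroot, hroot]

theorem lintegral_lintegral_sub_mul (G k : ℝ → ENNReal) (hG : Measurable G) (hk : Measurable k) :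
    ∫⁻ s, ∫⁻ t, k (t - s) * G s = (∫⁻ h, k h) * ∫⁻ s, G s := by
  have (s : ℝ) : ∫⁻ t, k (t - s) * G s = (∫⁻ h, k h) * G s := by
    rw [lintegral_mul_const _ (by fun_prop), lintegral_sub_right_eq_self]
  simp_rw [this]
  rw [lintegral_const_mul _ hG]

theorem lintegral_lintegral_sub_mul' (G k : ℝ → ENNReal) (hG : Measurable G) (hk : Measurable k) :
    ∫⁻ s, ∫⁻ t, k (t - s) * G t = (∫⁻ h, k h) * ∫⁻ s, G s := by
  rw [lintegral_lintegral_swap (by fun_prop)]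
  have (t : ℝ) : ∫⁻ s, k (t - s) * G t = (∫⁻ h, k h) * G t := by
    rw [lintegral_mul_const _ (by fun_prop), lintegral_sub_left_eq_self]
  simp_rw [this]
  rw [lintegral_const_mul _ hG]

theorem lintegral_lintegral_segment_average (G k : ℝ → ENNReal) (hG : Measurable G)
    (hk : Measurable k) :
    ∫⁻ s, ∫⁻ t, k (t - s) * ∫⁻ θ in Ioc (0 : ℝ) 1, G (s + θ * (t - s)) =
      (∫⁻ h, k h) * ∫⁻ s, G s := by
  have hm : Measurable fun p : ℝ × ℝ ↦ ∫⁻ θ in Ioc (0 : ℝ) 1, G (p.1 + θ * p.2) :=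
    Measurable.lintegral_prod_right' (f := fun q : (ℝ × ℝ) × ℝ ↦ G (q.1.1 + q.2 * q.1.2))
      (by fun_prop)
  have hshift (s : ℝ) : ∫⁻ t, k (t - s) * ∫⁻ θ in Ioc (0 : ℝ) 1, G (s + θ * (t - s)) =
      ∫⁻ h, k h * ∫⁻ θ in Ioc (0 : ℝ) 1, G (s + θ * h) :=
    lintegral_sub_right_eq_self (fun h ↦ k h * ∫⁻ θ in Ioc (0 : ℝ) 1, G (s + θ * h)) s
  simp_rw [hshift]
  rw [lintegral_lintegral_swap (by
    exact ((hk.comp measurable_snd).mul hm).aemeasurable)]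
  have hinner (h : ℝ) : ∫⁻ s, k h * ∫⁻ θ in Ioc (0 : ℝ) 1, G (s + θ * h) =
      k h * ∫⁻ s, G s := by
    have hmh : Measurable fun s ↦ ∫⁻ θ in Ioc (0 : ℝ) 1, G (s + θ * h) :=
      hm.comp (measurable_id.prodMk measurable_const)
    rw [lintegral_const_mul _ hmh,
      lintegral_lintegral_swap (by fun_prop)]
    simp [lintegral_add_right_eq_self G]
  simp_rw [hinner]
  rw [lintegral_mul_const _ hk]

theorem ofReal_norm_sq_div {E : Type*} [NormedAddCommGroup E] (x : E) {r : ℝ} (hr : 0 < r) :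
    ENNReal.ofReal (‖x‖ ^ 2 / r) = ‖x‖ₑ ^ 2 / ENNReal.ofReal r := by
  rw [ENNReal.ofReal_div_of_pos hr, ENNReal.ofReal_pow (norm_nonneg _), ofReal_norm]

section

variable {E : Type*} [NormedAddCommGroup E] [NormedSpace ℝ E] [CompleteSpace E] {g v : ℝ → E}

theorem enorm_sub_sq_le_mul_lintegral_deriv (hg : ∀ x, HasDerivAt g (v x) x) (hv : Continuous v)
    {a b : ℝ} (hab : a ≤ b) :
    ‖g b - g a‖ₑ ^ 2 ≤ ENNReal.ofReal (b - a) * ∫⁻ x in Ioc a b, ‖v x‖ₑ ^ 2 := by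
  rw [← intervalIntegral.integral_eq_sub_of_hasDerivAt (fun x _ ↦ hg x)
    (hv.intervalIntegrable a b), intervalIntegral.integral_of_le hab]
  calc ‖∫ x in Ioc a b, v x‖ₑ ^ 2 ≤ (∫⁻ x in Ioc a b, ‖v x‖ₑ) ^ 2 := by
        gcongr
        exact enorm_integral_le_lintegral_enorm _
    _ ≤ _ := by
        simpa using lintegral_sq_le_measure_mul (μ := volume.restrict (Ioc a b))
          hv.enorm.measurable.aemeasurable

theorem enorm_sub_sq_le_mul_lintegral_segment (hg : ∀ x, HasDerivAt g (v x) x)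
    (hv : Continuous v) (s t : ℝ) :
    ‖g t - g s‖ₑ ^ 2 ≤
      ENNReal.ofReal ((t - s) ^ 2) * ∫⁻ θ in Ioc (0 : ℝ) 1, ‖v (s + θ * (t - s))‖ₑ ^ 2 := by
  have hd (θ : ℝ) : HasDerivAt (fun θ ↦ g (s + θ * (t - s))) ((t - s) • v (s + θ * (t - s))) θ := by
    have h1 : HasDerivAt (fun θ : ℝ ↦ s + θ * (t - s)) (t - s) θ := by
      simpa using ((hasDerivAt_id θ).mul_const (t - s)).const_add s
    exact (hg _).scomp θ h1
  have hc : Continuous fun θ ↦ v (s + θ * (t - s)) := by fun_prop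
  have h := enorm_sub_sq_le_mul_lintegral_deriv hd (by fun_prop) zero_le_one
  have hsq : ‖t - s‖ₑ ^ 2 = ENNReal.ofReal ((t - s) ^ 2) := by
    rw [Real.enorm_eq_ofReal_abs, ← ENNReal.ofReal_pow (abs_nonneg _), sq_abs]
  simp only [enorm_smul, mul_pow] at h
  rw [lintegral_const_mul _ (hc.enorm.measurable.pow_const 2), hsq] at h
  simpa using h

theorem lintegral_lintegral_ofReal_norm_sub_sq_div_le (hg : ∀ x, HasDerivAt g (v x) x)
    (hv : Continuous v) :
    ∫⁻ s in Ioi (0 : ℝ), ∫⁻ t in Ioi (0 : ℝ), ENNReal.ofReal (‖g s - g t‖ ^ 2 / (s - t) ^ 2) ≤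
      2 * (∫⁻ s in Ioi (0 : ℝ), ‖v s‖ₑ ^ 2) +
        ENNReal.ofReal (8 * Real.pi) * ∫⁻ s in Ioi (0 : ℝ), ‖g s‖ₑ ^ 2 := by
  have hgc : Continuous g := continuous_iff_continuousAt.2 fun x ↦ (hg x).continuousAt
  let G : ℝ → ENNReal := (Ioi 0).indicator fun s ↦ ‖v s‖ₑ ^ 2
  let H : ℝ → ENNReal := (Ioi 0).indicator fun s ↦ ‖g s‖ₑ ^ 2
  let k₀ : ℝ → ENNReal := (Icc (-1) 1).indicator fun _ ↦ 1
  let k₁ : ℝ → ENNReal := fun h ↦ ENNReal.ofReal (4 * (1 + h ^ 2)⁻¹)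
  have hG : Measurable G := (hv.enorm.measurable.pow_const 2).indicator measurableSet_Ioi
  have hH : Measurable H := (hgc.enorm.measurable.pow_const 2).indicator measurableSet_Ioi
  have hk₀ : Measurable k₀ := measurable_const.indicator measurableSet_Icc
  have hk₁ : Measurable k₁ := by fun_prop
  have hIk₀ : ∫⁻ h, k₀ h = 2 := by
    simp only [k₀]
    rw [lintegral_indicator_const measurableSet_Icc]
    norm_num
  have hIk₁ : ∫⁻ h, k₁ h = ENNReal.ofReal (4 * Real.pi) := by
    simp only [k₁]
    rw [← ofReal_integral_eq_lintegral_ofReal (integrable_inv_one_add_sq.const_mul 4)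
      (ae_of_all _ fun x ↦ by positivity), integral_const_mul, integral_univ_inv_one_add_sq]
  have hpt (s t : ℝ) (hs : 0 < s) (ht : 0 < t) :
      ENNReal.ofReal (‖g s - g t‖ ^ 2 / (s - t) ^ 2) ≤
        k₀ (t - s) * (∫⁻ θ in Ioc (0 : ℝ) 1, G (s + θ * (t - s))) +
          (k₁ (t - s) * H s + k₁ (t - s) * H t) := by
    rcases eq_or_ne s t with rfl | hst
    · simp
    have hpos : 0 < (t - s) ^ 2 := by
      have := sub_ne_zero.2 hst.symm
      positivity
    rw [norm_sub_rev, ← neg_sub t s, neg_sq, ofReal_norm_sq_div _ hpos]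
    by_cases h : t - s ∈ Icc (-1 : ℝ) 1
    · refine le_add_right ?_
      simp only [k₀, indicator_of_mem h, one_mul]
      rw [setLIntegral_congr_fun (g := fun θ ↦ ‖v (s + θ * (t - s))‖ₑ ^ 2) measurableSet_Ioc]
      · refine ENNReal.div_le_of_le_mul' ?_
        exact enorm_sub_sq_le_mul_lintegral_segment hg hv s t
      · intro θ hθ
        refine indicator_of_mem ?_ _
        simp only [mem_Ioi]
        nlinarith [hθ.1, hθ.2, mul_pos hθ.1 ht, mul_nonneg (sub_nonneg.2 hθ.2) hs.le]
    · refine le_add_left ?_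
      have h1 : 1 ≤ (t - s) ^ 2 := by
        rw [mem_Icc, ← abs_le, not_le] at h
        rw [← sq_abs]
        nlinarith
      have hk : 2 / ENNReal.ofReal ((t - s) ^ 2) ≤ k₁ (t - s) := by
        rw [show (2 : ENNReal) = ENNReal.ofReal 2 by simp, ← ENNReal.ofReal_div_of_pos hpos]
        refine ENNReal.ofReal_le_ofReal ?_
        rw [← div_eq_mul_inv, div_le_div_iff₀ hpos (by positivity)]
        linarith
      have hHs : H s = ‖g s‖ₑ ^ 2 := indicator_of_mem (mem_Ioi.2 hs) _
      have hHt : H t = ‖g t‖ₑ ^ 2 := indicator_of_mem (mem_Ioi.2 ht) _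
      rw [← mul_add, hHs, hHt]
      calc ‖g t - g s‖ₑ ^ 2 / ENNReal.ofReal ((t - s) ^ 2)
          ≤ 2 * (‖g t‖ₑ ^ 2 + ‖g s‖ₑ ^ 2) / ENNReal.ofReal ((t - s) ^ 2) := by
            gcongr
            exact enorm_sub_sq_le_two_mul _ _
        _ = 2 / ENNReal.ofReal ((t - s) ^ 2) * (‖g s‖ₑ ^ 2 + ‖g t‖ₑ ^ 2) := by
            rw [add_comm, ENNReal.mul_div_right_comm]
        _ ≤ _ := by gcongr
  have hm : Measurable fun p : ℝ × ℝ ↦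
      k₀ (p.2 - p.1) * ∫⁻ θ in Ioc (0 : ℝ) 1, G (p.1 + θ * (p.2 - p.1)) := by
    refine Measurable.mul (by fun_prop) ?_
    exact Measurable.lintegral_prod_right'
      (f := fun q : (ℝ × ℝ) × ℝ ↦ G (q.1.1 + q.2 * (q.1.2 - q.1.1))) (by fun_prop)
  calc _ ≤ ∫⁻ s in Ioi (0 : ℝ), ∫⁻ t in Ioi (0 : ℝ),
          (k₀ (t - s) * (∫⁻ θ in Ioc (0 : ℝ) 1, G (s + θ * (t - s))) +
          (k₁ (t - s) * H s + k₁ (t - s) * H t)) :=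
        setLIntegral_mono' measurableSet_Ioi fun s hs ↦
          setLIntegral_mono' measurableSet_Ioi fun t ht ↦ hpt s t hs ht
    _ ≤ ∫⁻ s, ∫⁻ t, (k₀ (t - s) * (∫⁻ θ in Ioc (0 : ℝ) 1, G (s + θ * (t - s))) +
          (k₁ (t - s) * H s + k₁ (t - s) * H t)) :=
        (setLIntegral_le_lintegral _ _).trans
          (lintegral_mono fun s ↦ setLIntegral_le_lintegral _ _)
    _ = 2 * (∫⁻ s, G s) + (ENNReal.ofReal (4 * Real.pi) * (∫⁻ s, H s) +
          ENNReal.ofReal (4 * Real.pi) * (∫⁻ s, H s)) := by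
        have h1 (s : ℝ) : Measurable fun t ↦
            k₀ (t - s) * ∫⁻ θ in Ioc (0 : ℝ) 1, G (s + θ * (t - s)) :=
          hm.comp (measurable_const.prodMk measurable_id)
        have h2 (s : ℝ) : Measurable fun t ↦ k₁ (t - s) * H s := by fun_prop
        simp_rw [lintegral_add_left (h1 _), lintegral_add_left (h2 _)]
        rw [lintegral_add_left hm.lintegral_prod_right', lintegral_add_left (by
            exact (by fun_prop : Measurable fun p : ℝ × ℝ ↦
              k₁ (p.2 - p.1) * H p.1).lintegral_prod_right'),
          lintegral_lintegral_segment_average G k₀ hG hk₀, lintegral_lintegral_sub_mul H k₁ hH hk₁,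
          lintegral_lintegral_sub_mul' H k₁ hH hk₁, hIk₀, hIk₁]
    _ = _ := by
        rw [← add_mul, ← ENNReal.ofReal_add (by positivity) (by positivity),
          lintegral_indicator measurableSet_Ioi, lintegral_indicator measurableSet_Ioi]
        ring_nf

theorem lintegral_ofReal_norm_sq_div_le (hg : ∀ x, HasDerivAt g (v x) x)
    (hv : Continuous v) (hg0 : g 0 = 0) :
    ∫⁻ s in Ioi (0 : ℝ), ENNReal.ofReal (‖g s‖ ^ 2 / s) ≤
      (∫⁻ s in Ioi (0 : ℝ), ‖v s‖ₑ ^ 2) + ∫⁻ s in Ioi (0 : ℝ), ‖g s‖ₑ ^ 2 := by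
  rw [← Ioc_union_Ioi_eq_Ioi (zero_le_one' ℝ), lintegral_union measurableSet_Ioi (by simp),
    Ioc_union_Ioi_eq_Ioi (zero_le_one' ℝ)]
  refine add_le_add ?_ ?_
  · calc _ ≤ ∫⁻ s in Ioc (0 : ℝ) 1, ∫⁻ x in Ioi (0 : ℝ), ‖v x‖ₑ ^ 2 := by
          refine setLIntegral_mono' measurableSet_Ioc fun s hs ↦ ?_
          rw [ofReal_norm_sq_div _ hs.1]
          refine ENNReal.div_le_of_le_mul' ?_
          have h := enorm_sub_sq_le_mul_lintegral_deriv hg hv hs.1.le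
          rw [hg0, sub_zero, sub_zero] at h
          refine h.trans ?_
          gcongr
          exact Ioc_subset_Ioi_self
      _ = _ := by simp
  · calc _ ≤ ∫⁻ s in Ioi (1 : ℝ), ‖g s‖ₑ ^ 2 := by
          refine setLIntegral_mono' measurableSet_Ioi fun s hs ↦ ?_
          have hs : 1 < s := hs
          rw [ofReal_norm_sq_div _ (by linarith)]
          refine ENNReal.div_le_of_le_mul' (le_mul_of_one_le_left zero_le ?_)
          simpa using hs.le
      _ ≤ _ := lintegral_mono_set (Ioi_subset_Ioi zero_le_one)

theorem enorm_zero_sq_le (hg : ∀ x, HasDerivAt g (v x) x) (hv : Continuous v) :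
    ‖g 0‖ₑ ^ 2 ≤
      2 * ((∫⁻ s in Ioi (0 : ℝ), ‖g s‖ₑ ^ 2) + ∫⁻ s in Ioi (0 : ℝ), ‖v s‖ₑ ^ 2) := by
  have hgc : Continuous g := continuous_iff_continuousAt.2 fun x ↦ (hg x).continuousAt
  calc ‖g 0‖ₑ ^ 2 = ∫⁻ s in Ioc (0 : ℝ) 1, ‖g 0‖ₑ ^ 2 := by simp
    _ ≤ ∫⁻ s in Ioc (0 : ℝ) 1, 2 * (‖g s‖ₑ ^ 2 + ∫⁻ x in Ioi (0 : ℝ), ‖v x‖ₑ ^ 2) := by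
        refine setLIntegral_mono' measurableSet_Ioc fun s hs ↦ ?_
        have h1 := enorm_sub_sq_le_two_mul (g s) (g s - g 0)
        rw [sub_sub_cancel] at h1
        refine h1.trans ?_
        gcongr
        refine (enorm_sub_sq_le_mul_lintegral_deriv hg hv hs.1.le).trans ?_
        rw [← one_mul (∫⁻ x in Ioi (0 : ℝ), ‖v x‖ₑ ^ 2)]
        gcongr
        · simpa using hs.2
        · exact Ioc_subset_Ioi_self
    _ = 2 * ((∫⁻ s in Ioc (0 : ℝ) 1, ‖g s‖ₑ ^ 2) + ∫⁻ s in Ioi (0 : ℝ), ‖v s‖ₑ ^ 2) := by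
        have hm : Measurable fun s ↦ ‖g s‖ₑ ^ 2 := hgc.enorm.measurable.pow_const 2
        rw [lintegral_const_mul _ (by fun_prop), lintegral_add_left hm]
        simp
    _ ≤ _ := by
        gcongr
        exact Ioc_subset_Ioi_self

end

theorem lintegral_enorm_sq_lt_top_of_eq_zero {E : Type*} [NormedAddCommGroup E] {φ : ℝ → E}
    (hφ : Continuous φ) (hzero : ∀ s, 1 < s → φ s = 0) :
    ∫⁻ s in Ioi (0 : ℝ), ‖φ s‖ₑ ^ 2 < ⊤ := by
  rw [← Ioc_union_Ioi_eq_Ioi (zero_le_one' ℝ), lintegral_union measurableSet_Ioi (by simp),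
    setLIntegral_congr_fun (s := Ioi 1) (g := fun _ ↦ 0) measurableSet_Ioi
      (fun s hs ↦ by simp [hzero s hs]), lintegral_zero, add_zero]
  have h : IntegrableOn (fun s ↦ ‖φ s‖ ^ 2) (Ioc 0 1) :=
    (by fun_prop : Continuous fun s ↦ ‖φ s‖ ^ 2).integrableOn_Ioc
  simpa [HasFiniteIntegral] using h.2

theorem lintegral_enorm_sub_mul_sq_le (u ψ : ℝ → ℂ) (hu : Continuous u) (hψ : Continuous ψ)
    (c : ℂ) {M : ENNReal} (hM : ‖c‖ₑ ^ 2 ≤ 2 * M) (huM : ∫⁻ s in Ioi (0 : ℝ), ‖u s‖ₑ ^ 2 ≤ M) :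
    ∫⁻ s in Ioi (0 : ℝ), ‖u s - c * ψ s‖ₑ ^ 2 ≤
      (2 + 4 * ∫⁻ s in Ioi (0 : ℝ), ‖ψ s‖ₑ ^ 2) * M := by
  calc _ ≤ ∫⁻ s in Ioi (0 : ℝ), 2 * (‖u s‖ₑ ^ 2 + ‖c‖ₑ ^ 2 * ‖ψ s‖ₑ ^ 2) :=
        lintegral_mono fun s ↦ by simpa [mul_pow] using enorm_sub_sq_le_two_mul (u s) (c * ψ s)
    _ = 2 * ((∫⁻ s in Ioi (0 : ℝ), ‖u s‖ₑ ^ 2) +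
          ‖c‖ₑ ^ 2 * ∫⁻ s in Ioi (0 : ℝ), ‖ψ s‖ₑ ^ 2) := by
        rw [lintegral_const_mul _ (by fun_prop), lintegral_add_left (by fun_prop),
          lintegral_const_mul _ (by fun_prop)]
    _ ≤ 2 * (M + 2 * M * ∫⁻ s in Ioi (0 : ℝ), ‖ψ s‖ₑ ^ 2) := by gcongr
    _ = _ := by ring

theorem ofReal_setIntegral_norm_sq {u : ℝ → ℂ} (hu : Continuous u) (hcs : HasCompactSupport u) :
    ENNReal.ofReal (∫ s in Ioi (0 : ℝ), ‖u s‖ ^ 2) = ∫⁻ s in Ioi (0 : ℝ), ‖u s‖ₑ ^ 2 := by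
  have hi : Integrable fun s ↦ ‖u s‖ ^ 2 :=
    (by fun_prop : Continuous fun s ↦ ‖u s‖ ^ 2).integrable_of_hasCompactSupport
      (hcs.norm.comp_left (g := fun x : ℝ ↦ x ^ 2) (by simp))
  rw [ofReal_integral_eq_lintegral_ofReal hi.integrableOn (ae_of_all _ fun x ↦ by positivity)]
  simp only [ENNReal.ofReal_pow (norm_nonneg _), ofReal_norm]

/-- Lemma 2.5, embedding `H¹ ⊂ W^{1/2}`: for a fixed cut-off function `φ`,
there is `C > 0` (depending only on `φ`) such that for every `f ∈ C_c^∞([0,∞))`, the function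
`g = f − f(0)φ` satisfies
`∫₀^∞ |g(s)|² s^{−1} ds + ∫₀^∞∫₀^∞ |g(s)−g(t)|²/|s−t|² ds dt ≤ C(‖f‖_{L²}² + ‖f'‖_{L²}²)`. -/
theorem H1_subset_W_half (φ : ℝ → ℝ)
    (hφsmooth : ContDiff ℝ (⊤ : ℕ∞) φ) (hφmono : AntitoneOn φ (Ici 0))
    (hφone : ∃ δ > 0, ∀ s ∈ Icc (0 : ℝ) δ, φ s = 1)
    (hφzero : ∀ s : ℝ, 1 ≤ s → φ s = 0) :
    ∃ C > 0, ∀ f : ℝ → ℂ, ContDiff ℝ (⊤ : ℕ∞) f → HasCompactSupport f →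
      (∫ s in Ioi (0 : ℝ), ‖f s - f 0 * (φ s : ℂ)‖ ^ 2 / s) +
        (∫ s in Ioi (0 : ℝ), ∫ t in Ioi (0 : ℝ),
          ‖(f s - f 0 * (φ s : ℂ)) - (f t - f 0 * (φ t : ℂ))‖ ^ 2 / (s - t) ^ 2)
      ≤ C * ((∫ s in Ioi (0 : ℝ), ‖f s‖ ^ 2) + (∫ s in Ioi (0 : ℝ), ‖deriv f s‖ ^ 2)) := by
  have hφ0 : φ 0 = 1 := by
    obtain ⟨δ, hδ, h⟩ := hφone
    exact h 0 ⟨le_rfl, hδ.le⟩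
  have hφc : Continuous fun s ↦ (φ s : ℂ) := Complex.continuous_ofReal.comp hφsmooth.continuous
  have hφ'c : Continuous fun s ↦ ((deriv φ s : ℝ) : ℂ) :=
    Complex.continuous_ofReal.comp (hφsmooth.continuous_deriv (by simp))
  have hφd (x : ℝ) : HasDerivAt (fun s ↦ (φ s : ℂ)) ((deriv φ x : ℝ) : ℂ) x :=
    (hφsmooth.differentiable (by simp) x).hasDerivAt.ofReal_comp
  have hP₀ := lintegral_enorm_sq_lt_top_of_eq_zero hφc fun s hs ↦ by simp [hφzero s hs.le]
  have hP₁ := lintegral_enorm_sq_lt_top_of_eq_zero hφ'c fun s hs ↦ by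
    have h : φ =ᶠ[nhds s] fun _ ↦ 0 :=
      Filter.eventually_of_mem (Ioi_mem_nhds hs) fun x hx ↦ hφzero x (le_of_lt hx)
    simp [h.deriv_eq]
  set P₀ := ∫⁻ s in Ioi (0 : ℝ), ‖(φ s : ℂ)‖ₑ ^ 2
  set P₁ := ∫⁻ s in Ioi (0 : ℝ), ‖((deriv φ s : ℝ) : ℂ)‖ₑ ^ 2
  let K : ENNReal := 3 * (2 + 4 * P₁) + (1 + ENNReal.ofReal (8 * Real.pi)) * (2 + 4 * P₀)
  have hK : K ≠ ⊤ := by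
    simp [K, ENNReal.add_eq_top, ENNReal.mul_eq_top, hP₀.ne, hP₁.ne]
  refine ⟨K.toReal, ENNReal.toReal_pos (by simp [K]) hK, fun f hf hfc ↦ ?_⟩
  have hfd (x : ℝ) : HasDerivAt f (deriv f x) x := (hf.differentiable (by simp) x).hasDerivAt
  have hf'c : Continuous (deriv f) := hf.continuous_deriv (by simp)
  let g : ℝ → ℂ := fun s ↦ f s - f 0 * φ s
  let v : ℝ → ℂ := fun s ↦ deriv f s - f 0 * deriv φ s
  have hg (x : ℝ) : HasDerivAt g (v x) x := (hfd x).sub ((hφd x).const_mul (f 0))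
  have hv : Continuous v := hf'c.sub (continuous_const.mul hφ'c)
  have hg0 : g 0 = 0 := by simp [g, hφ0]
  have hN₀ := ofReal_setIntegral_norm_sq hf.continuous hfc
  have hN₁ := ofReal_setIntegral_norm_sq hf'c hfc.deriv
  have h0 := enorm_zero_sq_le hfd hf'c
  set N := (∫⁻ s in Ioi (0 : ℝ), ‖f s‖ₑ ^ 2) + ∫⁻ s in Ioi (0 : ℝ), ‖deriv f s‖ₑ ^ 2 with hN
  have hgN : ∫⁻ s in Ioi (0 : ℝ), ‖g s‖ₑ ^ 2 ≤ (2 + 4 * P₀) * N :=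
    lintegral_enorm_sub_mul_sq_le f _ hf.continuous hφc (f 0) h0 le_self_add
  have hvN : ∫⁻ s in Ioi (0 : ℝ), ‖v s‖ₑ ^ 2 ≤ (2 + 4 * P₁) * N :=
    lintegral_enorm_sub_mul_sq_le (deriv f) _ hf'c hφ'c (f 0) h0 le_add_self
  have hI : ‖∫ s in Ioi (0 : ℝ), ‖g s‖ ^ 2 / s‖ₑ ≤
      ∫⁻ s in Ioi (0 : ℝ), ENNReal.ofReal (‖g s‖ ^ 2 / s) := by
    refine (enorm_integral_le_lintegral_enorm _).trans_eq ?_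
    refine setLIntegral_congr_fun measurableSet_Ioi fun s hs ↦ ?_
    have hs : 0 < s := hs
    exact Real.enorm_of_nonneg (by positivity)
  have hJ : ‖∫ s in Ioi (0 : ℝ), ∫ t in Ioi (0 : ℝ), ‖g s - g t‖ ^ 2 / (s - t) ^ 2‖ₑ ≤
      ∫⁻ s in Ioi (0 : ℝ), ∫⁻ t in Ioi (0 : ℝ),
        ENNReal.ofReal (‖g s - g t‖ ^ 2 / (s - t) ^ 2) := by
    refine (enorm_integral_le_lintegral_enorm _).trans (lintegral_mono fun s ↦ ?_)
    refine (enorm_integral_le_lintegral_enorm _).trans_eq (lintegral_congr fun t ↦ ?_)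
    exact Real.enorm_of_nonneg (by positivity)
  have hbound := calc
    ‖(∫ s in Ioi (0 : ℝ), ‖g s‖ ^ 2 / s) +
        ∫ s in Ioi (0 : ℝ), ∫ t in Ioi (0 : ℝ), ‖g s - g t‖ ^ 2 / (s - t) ^ 2‖ₑ
      ≤ ((2 + 4 * P₁) * N + (2 + 4 * P₀) * N) +
          (2 * ((2 + 4 * P₁) * N) + ENNReal.ofReal (8 * Real.pi) * ((2 + 4 * P₀) * N)) := by
        refine (enorm_add_le _ _).trans (add_le_add ?_ ?_)
        · exact (hI.trans (lintegral_ofReal_norm_sq_div_le hg hv hg0)).trans (by gcongr)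
        · exact (hJ.trans (lintegral_lintegral_ofReal_norm_sub_sq_div_le hg hv)).trans (by gcongr)
    _ = K * N := by ring
    _ = ENNReal.ofReal (K.toReal * ((∫ s in Ioi (0 : ℝ), ‖f s‖ ^ 2) +
          ∫ s in Ioi (0 : ℝ), ‖deriv f s‖ ^ 2)) := by
        rw [ENNReal.ofReal_mul ENNReal.toReal_nonneg, ENNReal.ofReal_toReal hK,
          ENNReal.ofReal_add (integral_nonneg fun _ ↦ by positivity)
            (integral_nonneg fun _ ↦ by positivity), hN₀, hN₁]
  rw [Real.enorm_eq_ofReal_abs] at hbound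
  refine (le_abs_self _).trans ((ENNReal.ofReal_le_ofReal_iff ?_).1 hbound)
  exact mul_nonneg ENNReal.toReal_nonneg (add_nonneg (integral_nonneg fun _ ↦ by positivity)
    (integral_nonneg fun _ ↦ by positivity))
end

section
/- Let α ∈ (0,2π) with α ≠ π. For every z ∈ ℂ with −1 < Re z < 1 and z ≠ 0, the integral ∫₀^∞ s^{z−1} · (s sin α)/(π(s² − 2s cos α + 1)) ds converges absolutely and equals sin((π−α)z)/sin(πz). -/
open MeasureTheory Set

open Filter Topology

theorem image_div_one_sub_Ioo : (fun t : ℝ => t / (1 - t)) '' Ioo 0 1 = Ioi 0 := by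
  ext s
  simp only [mem_image, mem_Ioo, mem_Ioi]
  constructor
  · rintro ⟨t, ⟨h0, h1⟩, rfl⟩
    exact div_pos h0 (by linarith)
  · intro hs
    refine ⟨s / (1 + s), ⟨by positivity, ?_⟩, ?_⟩
    · rw [div_lt_one (by positivity)]; linarith
    · have : 1 - s / (1 + s) = 1 / (1 + s) := by field_simp; ring
      rw [this]
      field_simp

theorem hasDerivAt_div_one_sub {t : ℝ} (ht : 1 - t ≠ 0) :
    HasDerivAt (fun t : ℝ => t / (1 - t)) (1 / (1 - t) ^ 2) t := by
  convert! (hasDerivAt_id t).div ((hasDerivAt_id t).const_sub 1) ht using 1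
  simp

theorem injOn_div_one_sub_Ioo : InjOn (fun t : ℝ => t / (1 - t)) (Ioo 0 1) := by
  intro a ha b hb h
  have h1 : 1 - a ≠ 0 := by linarith [ha.2]
  have h2 : 1 - b ≠ 0 := by linarith [hb.2]
  simp only [div_eq_div_iff h1 h2] at h
  linarith

theorem abs_deriv_smul_cpow_div_one_sub (z : ℂ) {t : ℝ} (ht : t ∈ Ioo (0 : ℝ) 1) :
    |1 / (1 - t) ^ 2| • (((t / (1 - t) : ℝ) : ℂ) ^ z / (1 + ((t / (1 - t) : ℝ) : ℂ)) ^ 2) =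
      (t : ℂ) ^ (z + 1 - 1) * (1 - (t : ℂ)) ^ (1 - z - 1) := by
  have h1 : 0 < 1 - t := by linarith [ht.2]
  have hc : (1 - (t : ℂ)) = ((1 - t : ℝ) : ℂ) := by push_cast; rfl
  have h1c : ((1 - t : ℝ) : ℂ) ≠ 0 := by exact_mod_cast h1.ne'
  have key : (1 + ((t / (1 - t) : ℝ) : ℂ)) = 1 / ((1 - t : ℝ) : ℂ) := by
    norm_cast
    field_simp
    ring
  rw [key, abs_of_pos (by positivity), Complex.real_smul, add_sub_cancel_right,
    show 1 - z - 1 = -z by ring, hc, Complex.cpow_neg, div_eq_mul_inv t, Complex.ofReal_mul,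
    Complex.mul_cpow_ofReal_nonneg ht.1.le (by positivity), Complex.ofReal_inv,
    Complex.inv_cpow _ _ (by rw [Complex.arg_ofReal_of_nonneg h1.le]; exact Real.pi_pos.ne),
    Complex.ofReal_div, Complex.ofReal_pow]
  field_simp
  simp

theorem integrableOn_cpow_div_one_add_sq {z : ℂ} (hz1 : -1 < z.re) (hz2 : z.re < 1) :
    IntegrableOn (fun s : ℝ => (s : ℂ) ^ z / (1 + (s : ℂ)) ^ 2) (Ioi 0) := by
  rw [← image_div_one_sub_Ioo, integrableOn_image_iff_integrableOn_abs_deriv_smul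
    measurableSet_Ioo (fun t ht => (hasDerivAt_div_one_sub
      (by linarith [ht.2])).hasDerivWithinAt) injOn_div_one_sub_Ioo]
  rw [integrableOn_congr_fun (fun t ht => abs_deriv_smul_cpow_div_one_sub z ht)
    measurableSet_Ioo, ← intervalIntegrable_iff_integrableOn_Ioo_of_le zero_le_one]
  exact Complex.betaIntegral_convergent (by simp; linarith) (by simp; linarith)

theorem integral_cpow_div_one_add_sq {z : ℂ} (hz1 : -1 < z.re) (hz2 : z.re < 1) (hz0 : z ≠ 0) :
    ∫ s in Ioi (0 : ℝ), (s : ℂ) ^ z / (1 + (s : ℂ)) ^ 2 =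
      Real.pi * z / Complex.sin (Real.pi * z) := by
  rw [← image_div_one_sub_Ioo, integral_image_eq_integral_abs_deriv_smul
    measurableSet_Ioo (fun t ht => (hasDerivAt_div_one_sub
      (by linarith [ht.2])).hasDerivWithinAt) injOn_div_one_sub_Ioo]
  rw [setIntegral_congr_fun measurableSet_Ioo (fun t ht => abs_deriv_smul_cpow_div_one_sub z ht),
    ← integral_Ioc_eq_integral_Ioo, ← intervalIntegral.integral_of_le zero_le_one]
  have := Complex.betaIntegral_eq_Gamma_mul_div (z + 1) (1 - z) (by simp; linarith)
    (by simp; linarith)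
  rw [Complex.betaIntegral] at this
  rw [this, Complex.Gamma_add_one z hz0, mul_assoc, Complex.Gamma_mul_Gamma_one_sub,
    show z + 1 + (1 - z) = 1 + 1 by ring, Complex.Gamma_add_one 1 one_ne_zero, Complex.Gamma_one]
  ring

/-- A lower bound for the distance from `-s` to a point of the unit circle. -/
theorem cos_half_mul_one_add_le_norm (s θ : ℝ) :
    Real.cos (θ / 2) * (1 + s) ≤ ‖(s : ℂ) + Complex.exp (θ * Complex.I)‖ := by
  have h1 : ‖((s : ℂ) + Complex.exp (θ * Complex.I)) * Complex.exp ((-(θ / 2) : ℝ) * Complex.I)‖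
      = ‖(s : ℂ) + Complex.exp (θ * Complex.I)‖ := by
    rw [norm_mul, Complex.norm_exp_ofReal_mul_I, mul_one]
  rw [← h1]
  refine le_trans (le_of_eq ?_) (Complex.re_le_norm _)
  rw [add_mul, ← Complex.exp_add,
    show (θ : ℂ) * Complex.I + ((-(θ / 2) : ℝ) : ℂ) * Complex.I = ((θ / 2 : ℝ) : ℂ) * Complex.I by
      push_cast; ring]
  rw [Complex.add_re, Complex.re_ofReal_mul, Complex.exp_ofReal_mul_I_re,
    Complex.exp_ofReal_mul_I_re, Real.cos_neg]
  ring

theorem add_exp_ne_zero {s θ : ℝ} (hs : 0 < s) (hθ : θ ∈ Ioo (-Real.pi) Real.pi) :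
    (s : ℂ) + Complex.exp (θ * Complex.I) ≠ 0 := by
  rw [← norm_pos_iff]
  refine lt_of_lt_of_le (mul_pos ?_ (by linarith)) (cos_half_mul_one_add_le_norm s θ)
  exact Real.cos_pos_of_mem_Ioo ⟨by linarith [hθ.1], by linarith [hθ.2]⟩

theorem integrableOn_of_norm_le_cpow_div {z : ℂ} (hz1 : -1 < z.re) (hz2 : z.re < 1)
    {f : ℝ → ℂ} (hf : ContinuousOn f (Ioi 0)) (C : ℝ)
    (hle : ∀ s : ℝ, 0 < s → ‖f s‖ ≤ C * ‖(s : ℂ) ^ z / (1 + (s : ℂ)) ^ 2‖) :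
    IntegrableOn f (Ioi 0) :=
  ((integrableOn_cpow_div_one_add_sq hz1 hz2).norm.const_mul C).mono'
    (hf.aestronglyMeasurable measurableSet_Ioi)
    ((ae_restrict_iff' measurableSet_Ioi).2 (.of_forall hle))

theorem integral_deriv_eq_zero_of_norm_le_cpow_div {z : ℂ} (hz1 : -1 < z.re) (hz2 : z.re < 1)
    {f f' : ℝ → ℂ} (hf : ∀ s ∈ Ioi (0 : ℝ), HasDerivAt f (f' s) s)
    (hf' : IntegrableOn f' (Ioi 0)) (C : ℝ)
    (hle : ∀ s : ℝ, 0 < s → ‖f s‖ ≤ C * (s * ‖(s : ℂ) ^ z / (1 + (s : ℂ)) ^ 2‖)) :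
    ∫ s in Ioi (0 : ℝ), f' s = 0 := by
  have hbd : ∀ s : ℝ, 0 < s → s * ‖(s : ℂ) ^ z / (1 + (s : ℂ)) ^ 2‖ =
      s ^ (z.re + 1) / (1 + s) ^ 2 := by
    intro s hs
    have : ‖1 + (s : ℂ)‖ = 1 + s := by
      rw [show 1 + (s : ℂ) = ((1 + s : ℝ) : ℂ) by push_cast; rfl, Complex.norm_real,
        Real.norm_of_nonneg (by linarith)]
    rw [norm_div, norm_pow, this, Complex.norm_cpow_eq_rpow_re_of_pos hs, Real.rpow_add_one hs.ne']
    ring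
  have h0 : Tendsto f (𝓝[>] 0) (𝓝 0) := by
    refine squeeze_zero_norm' (a := fun s => C * (s ^ (z.re + 1) / (1 + s) ^ 2)) ?_ ?_
    · filter_upwards [self_mem_nhdsWithin] with s hs
      rw [← hbd s hs]
      exact hle s hs
    · have : ContinuousAt (fun s : ℝ => C * (s ^ (z.re + 1) / (1 + s) ^ 2)) 0 := by
        refine continuousAt_const.mul (ContinuousAt.div ?_ (by fun_prop) (by norm_num))
        exact Real.continuousAt_rpow_const _ _ (Or.inr (by linarith))
      have h := this.tendsto
      simp only [Real.zero_rpow (show z.re + 1 ≠ 0 by linarith), zero_div, mul_zero] at h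
      exact h.mono_left nhdsWithin_le_nhds
  have h1 : Tendsto f atTop (𝓝 0) := by
    refine squeeze_zero_norm' (a := fun s => |C| * s ^ (-(1 - z.re))) ?_ ?_
    · filter_upwards [eventually_gt_atTop 0] with s hs
      refine (hle s hs).trans ?_
      rw [hbd s hs]
      refine mul_le_mul (le_abs_self C) ?_ (by positivity) (abs_nonneg C)
      rw [show -(1 - z.re) = z.re + 1 - (2 : ℕ) by push_cast; ring, Real.rpow_sub_natCast hs.ne']
      gcongr
      linarith
    · simpa using (tendsto_rpow_neg_atTop (by linarith : 0 < 1 - z.re)).const_mul |C|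
  have := integral_Ioi_deriv_mul_eq_sub (a := 0) (u := f) (u' := f') (v := fun _ => 1)
    (v' := fun _ => 0) (a' := (0 : ℂ)) (b' := 0) hf (fun x _ => hasDerivAt_const x 1)
    (by simpa [Pi.mul_def, Pi.add_def] using hf')
    (by simpa [Pi.mul_def] using h0) (by simpa [Pi.mul_def] using h1)
  simpa using this

theorem norm_cpow_mul_div_le (z : ℂ) {s : ℝ} (hs : 0 < s) {u v : ℂ} {C : ℝ} (hv : v ≠ 0)
    (huv : ‖u‖ * (1 + s) ^ 2 ≤ C * ‖v‖) :
    ‖(s : ℂ) ^ z * (u / v)‖ ≤ C * ‖(s : ℂ) ^ z / (1 + (s : ℂ)) ^ 2‖ := by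
  have h1 : ‖1 + (s : ℂ)‖ = 1 + s := by
    rw [show 1 + (s : ℂ) = ((1 + s : ℝ) : ℂ) by push_cast; rfl, Complex.norm_real,
      Real.norm_of_nonneg (by linarith)]
  have hv' : 0 < ‖v‖ := norm_pos_iff.2 hv
  rw [norm_mul, norm_div, norm_div, norm_pow, h1, mul_div_assoc', mul_div_assoc',
    div_le_div_iff₀ hv' (by positivity)]
  nlinarith [mul_le_mul_of_nonneg_left huv (norm_nonneg ((s : ℂ) ^ z))]

theorem norm_exp_le_mul_norm_sq {s θ c : ℝ} (hs : 0 < s) (hc : 0 < c)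
    (hcθ : c ≤ Real.cos (θ / 2)) :
    ‖Complex.exp (θ * Complex.I)‖ * (1 + s) ^ 2 ≤
      (c⁻¹) ^ 2 * ‖((s : ℂ) + Complex.exp (θ * Complex.I)) ^ 2‖ := by
  have h := (mul_le_mul_of_nonneg_right hcθ (by linarith : 0 ≤ 1 + s)).trans
    (cos_half_mul_one_add_le_norm s θ)
  rw [Complex.norm_exp_ofReal_mul_I, norm_pow, ← mul_pow, one_mul]
  gcongr
  rwa [inv_mul_eq_div, le_div_iff₀ hc, mul_comm]

theorem norm_exp_mul_sub_le_mul_norm_cube {s θ c : ℝ} (hs : 0 < s) (hc : 0 < c)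
    (hcθ : c ≤ Real.cos (θ / 2)) :
    ‖Complex.I * Complex.exp (θ * Complex.I) * (s - Complex.exp (θ * Complex.I))‖ * (1 + s) ^ 2 ≤
      (c⁻¹) ^ 3 * ‖((s : ℂ) + Complex.exp (θ * Complex.I)) ^ 3‖ := by
  have h := (mul_le_mul_of_nonneg_right hcθ (by linarith : 0 ≤ 1 + s)).trans
    (cos_half_mul_one_add_le_norm s θ)
  have h2 : ‖(s : ℂ) - Complex.exp (θ * Complex.I)‖ ≤ 1 + s := by
    refine (norm_sub_le _ _).trans ?_
    rw [Complex.norm_exp_ofReal_mul_I, Complex.norm_real, Real.norm_of_nonneg hs.le, add_comm]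
  rw [norm_mul, norm_mul, Complex.norm_I, Complex.norm_exp_ofReal_mul_I, norm_pow, ← mul_pow]
  calc 1 * 1 * ‖(s : ℂ) - Complex.exp (θ * Complex.I)‖ * (1 + s) ^ 2
      ≤ 1 * 1 * (1 + s) * (1 + s) ^ 2 := by gcongr
    _ = (1 + s) ^ 3 := by ring
    _ ≤ _ := by
      gcongr
      rwa [inv_mul_eq_div, le_div_iff₀ hc, mul_comm]

theorem continuousOn_ofReal_cpow_Ioi (z : ℂ) :
    ContinuousOn (fun s : ℝ => (s : ℂ) ^ z) (Ioi 0) := by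
  intro s hs
  exact (Complex.continuousAt_ofReal_cpow_const s z (Or.inr (ne_of_gt hs))).continuousWithinAt

theorem hasDerivAt_ofReal_cpow {z : ℂ} {s : ℝ} (hs : 0 < s) :
    HasDerivAt (fun s : ℝ => (s : ℂ) ^ z) (z * (s : ℂ) ^ (z - 1)) s := by
  have := ((hasDerivAt_id (s : ℂ)).cpow_const (c := z) (Or.inl (by simpa using hs))).comp_ofReal
  simpa using this

theorem cos_half_pos {θ : ℝ} (hθ : θ ∈ Ioo (-Real.pi) Real.pi) : 0 < Real.cos (θ / 2) :=
  Real.cos_pos_of_mem_Ioo ⟨by linarith [hθ.1], by linarith [hθ.2]⟩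

theorem integrableOn_cpow_mul_exp_div_sq {z : ℂ} (hz1 : -1 < z.re) (hz2 : z.re < 1) {θ : ℝ}
    (hθ : θ ∈ Ioo (-Real.pi) Real.pi) :
    IntegrableOn (fun s : ℝ => (s : ℂ) ^ z *
      (Complex.exp (θ * Complex.I) / ((s : ℂ) + Complex.exp (θ * Complex.I)) ^ 2)) (Ioi 0) := by
  refine integrableOn_of_norm_le_cpow_div hz1 hz2 ?_ ((Real.cos (θ / 2))⁻¹ ^ 2) fun s hs => ?_
  · exact (continuousOn_ofReal_cpow_Ioi z).mul (ContinuousOn.div (by fun_prop) (by fun_prop)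
      fun s hs => pow_ne_zero 2 (add_exp_ne_zero hs hθ))
  · exact norm_cpow_mul_div_le z hs (pow_ne_zero 2 (add_exp_ne_zero hs hθ))
      (norm_exp_le_mul_norm_sq hs (cos_half_pos hθ) le_rfl)

theorem integrableOn_cpow_mul_exp_div_cube {z : ℂ} (hz1 : -1 < z.re) (hz2 : z.re < 1) {θ : ℝ}
    (hθ : θ ∈ Ioo (-Real.pi) Real.pi) :
    IntegrableOn (fun s : ℝ => (s : ℂ) ^ z *
      (Complex.I * Complex.exp (θ * Complex.I) * (s - Complex.exp (θ * Complex.I)) /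
        ((s : ℂ) + Complex.exp (θ * Complex.I)) ^ 3)) (Ioi 0) := by
  refine integrableOn_of_norm_le_cpow_div hz1 hz2 ?_ ((Real.cos (θ / 2))⁻¹ ^ 3) fun s hs => ?_
  · exact (continuousOn_ofReal_cpow_Ioi z).mul (ContinuousOn.div (by fun_prop) (by fun_prop)
      fun s hs => pow_ne_zero 3 (add_exp_ne_zero hs hθ))
  · exact norm_cpow_mul_div_le z hs (pow_ne_zero 3 (add_exp_ne_zero hs hθ))
      (norm_exp_mul_sub_le_mul_norm_cube hs (cos_half_pos hθ) le_rfl)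

theorem hasDerivAt_exp_div_sq {s θ : ℝ} (hs : 0 < s) (hθ : θ ∈ Ioo (-Real.pi) Real.pi) :
    HasDerivAt (fun θ : ℝ => Complex.exp (θ * Complex.I) /
        ((s : ℂ) + Complex.exp (θ * Complex.I)) ^ 2)
      (Complex.I * Complex.exp (θ * Complex.I) * (s - Complex.exp (θ * Complex.I)) /
        ((s : ℂ) + Complex.exp (θ * Complex.I)) ^ 3) θ := by
  have hne := add_exp_ne_zero hs hθ
  have he : HasDerivAt (fun θ : ℝ => Complex.exp (θ * Complex.I))
      (Complex.exp (θ * Complex.I) * Complex.I) θ := by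
    have := ((hasDerivAt_id (θ : ℂ)).mul_const Complex.I).cexp.comp_ofReal
    simpa using this
  convert! he.div ((he.const_add (s : ℂ)).pow 2) (pow_ne_zero 2 hne) using 1
  simp only [Pi.pow_apply]
  generalize Complex.exp (θ * Complex.I) = e at hne ⊢
  field_simp
  push_cast
  ring

/-- The derivative in the angle of the Mellin transform of `s ↦ s e^{iθ} / (s + e^{iθ})²`. -/
theorem hasDerivAt_integral_cpow_mul_exp_div_sq {z : ℂ} (hz1 : -1 < z.re) (hz2 : z.re < 1)
    {θ : ℝ} (hθ : θ ∈ Ioo (-Real.pi) Real.pi) :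
    HasDerivAt (fun θ : ℝ => ∫ s in Ioi (0 : ℝ), (s : ℂ) ^ z *
      (Complex.exp (θ * Complex.I) / ((s : ℂ) + Complex.exp (θ * Complex.I)) ^ 2))
      (∫ s in Ioi (0 : ℝ), (s : ℂ) ^ z *
        (Complex.I * Complex.exp (θ * Complex.I) * (s - Complex.exp (θ * Complex.I)) /
          ((s : ℂ) + Complex.exp (θ * Complex.I)) ^ 3)) θ := by
  obtain ⟨r, hr1, hr2⟩ := exists_between (abs_lt.2 hθ)
  have hr0 : 0 < r := (abs_nonneg θ).trans_lt hr1
  have hsub : ∀ φ ∈ Ioo (-r) r, φ ∈ Ioo (-Real.pi) Real.pi :=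
    fun φ hφ => ⟨by linarith [hφ.1], by linarith [hφ.2]⟩
  have hc : 0 < Real.cos (r / 2) := cos_half_pos ⟨by linarith, hr2⟩
  have hnhds : Ioo (-r) r ∈ 𝓝 θ := Ioo_mem_nhds (abs_lt.1 hr1).1 (abs_lt.1 hr1).2
  refine (hasDerivAt_integral_of_dominated_loc_of_deriv_le
    (F := fun (θ : ℝ) (s : ℝ) => (s : ℂ) ^ z *
      (Complex.exp (θ * Complex.I) / ((s : ℂ) + Complex.exp (θ * Complex.I)) ^ 2))
    (F' := fun (θ : ℝ) (s : ℝ) => (s : ℂ) ^ z *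
      (Complex.I * Complex.exp (θ * Complex.I) * (s - Complex.exp (θ * Complex.I)) /
        ((s : ℂ) + Complex.exp (θ * Complex.I)) ^ 3))
    (bound := fun s : ℝ => (Real.cos (r / 2))⁻¹ ^ 3 * ‖(s : ℂ) ^ z / (1 + (s : ℂ)) ^ 2‖)
    hnhds ?_ (integrableOn_cpow_mul_exp_div_sq hz1 hz2 hθ)
    (integrableOn_cpow_mul_exp_div_cube hz1 hz2 hθ).aestronglyMeasurable ?_
    ((integrableOn_cpow_div_one_add_sq hz1 hz2).norm.const_mul _) ?_).2
  · filter_upwards [hnhds] with φ hφ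
    exact (integrableOn_cpow_mul_exp_div_sq hz1 hz2 (hsub φ hφ)).aestronglyMeasurable
  · refine (ae_restrict_iff' measurableSet_Ioi).2 (.of_forall fun s hs φ hφ => ?_)
    refine norm_cpow_mul_div_le z hs (pow_ne_zero 3 (add_exp_ne_zero hs (hsub φ hφ)))
      (norm_exp_mul_sub_le_mul_norm_cube hs hc ?_)
    rw [← Real.cos_abs (φ / 2)]
    have : |φ / 2| ≤ r / 2 := by
      rw [abs_le]; constructor <;> linarith [hφ.1, hφ.2]
    exact Real.cos_le_cos_of_nonneg_of_le_pi (abs_nonneg _) (by linarith) this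
  · refine (ae_restrict_iff' measurableSet_Ioi).2 (.of_forall fun s hs φ hφ => ?_)
    exact (hasDerivAt_exp_div_sq hs (hsub φ hφ)).const_mul _

theorem integral_cpow_mul_exp_div_cube {z : ℂ} (hz1 : -1 < z.re) (hz2 : z.re < 1)
    {θ : ℝ} (hθ : θ ∈ Ioo (-Real.pi) Real.pi) :
    ∫ s in Ioi (0 : ℝ), (s : ℂ) ^ z *
        (Complex.I * Complex.exp (θ * Complex.I) * (s - Complex.exp (θ * Complex.I)) /
          ((s : ℂ) + Complex.exp (θ * Complex.I)) ^ 3) =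
      Complex.I * z * ∫ s in Ioi (0 : ℝ), (s : ℂ) ^ z *
        (Complex.exp (θ * Complex.I) / ((s : ℂ) + Complex.exp (θ * Complex.I)) ^ 2) := by
  have hi2 := (integrableOn_cpow_mul_exp_div_sq hz1 hz2 hθ).const_mul (Complex.I * z)
  have hi3 := integrableOn_cpow_mul_exp_div_cube hz1 hz2 hθ
  rw [← integral_const_mul, eq_comm, ← sub_eq_zero, ← integral_sub hi2 hi3]
  refine integral_deriv_eq_zero_of_norm_le_cpow_div (z := z) hz1 hz2
    (f := fun s : ℝ => Complex.I * (s * ((s : ℂ) ^ z * (Complex.exp (θ * Complex.I) /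
      ((s : ℂ) + Complex.exp (θ * Complex.I)) ^ 2)))) ?_ (hi2.sub hi3)
    ((Real.cos (θ / 2))⁻¹ ^ 2) ?_
  · intro s hs
    have hne := add_exp_ne_zero hs hθ
    have hs' : (s : ℂ) ≠ 0 := by exact_mod_cast (ne_of_gt hs)
    have hid : HasDerivAt (fun s : ℝ => (s : ℂ)) 1 s := Complex.ofRealCLM.hasDerivAt
    convert! (hid.mul ((hasDerivAt_ofReal_cpow hs).mul ((hasDerivAt_const s
      (Complex.exp (θ * Complex.I))).div ((hid.add_const
        (Complex.exp (θ * Complex.I))).pow 2) (pow_ne_zero 2 hne)))).const_mul Complex.I using 1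
    simp only [Pi.pow_apply, Pi.div_apply, Pi.mul_apply]
    rw [Complex.cpow_sub _ _ hs', Complex.cpow_one]
    generalize Complex.exp (θ * Complex.I) = e at hne ⊢
    field_simp
    push_cast
    ring
  · intro s hs
    rw [norm_mul, norm_mul, Complex.norm_I, one_mul, Complex.norm_real, Real.norm_of_nonneg hs.le,
      mul_left_comm]
    gcongr
    exact norm_cpow_mul_div_le z hs (pow_ne_zero 2 (add_exp_ne_zero hs hθ))
      (norm_exp_le_mul_norm_sq hs (cos_half_pos hθ) le_rfl)

theorem integral_cpow_mul_exp_div_sq {z : ℂ} (hz1 : -1 < z.re) (hz2 : z.re < 1) (hz0 : z ≠ 0)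
    {θ : ℝ} (hθ : θ ∈ Ioo (-Real.pi) Real.pi) :
    ∫ s in Ioi (0 : ℝ), (s : ℂ) ^ z *
        (Complex.exp (θ * Complex.I) / ((s : ℂ) + Complex.exp (θ * Complex.I)) ^ 2) =
      Complex.exp (Complex.I * z * θ) * (Real.pi * z / Complex.sin (Real.pi * z)) := by
  set K : ℝ → ℂ := fun θ => ∫ s in Ioi (0 : ℝ), (s : ℂ) ^ z *
        (Complex.exp (θ * Complex.I) / ((s : ℂ) + Complex.exp (θ * Complex.I)) ^ 2) with hK
  have hd : ∀ φ ∈ Ioo (-Real.pi) Real.pi,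
      HasDerivAt (fun φ : ℝ => Complex.exp (-(Complex.I * z) * φ) * K φ) 0 φ := by
    intro φ hφ
    have h1 := hasDerivAt_integral_cpow_mul_exp_div_sq hz1 hz2 hφ
    rw [integral_cpow_mul_exp_div_cube hz1 hz2 hφ] at h1
    have h2 : HasDerivAt (fun φ : ℝ => Complex.exp (-(Complex.I * z) * φ))
        (Complex.exp (-(Complex.I * z) * φ) * -(Complex.I * z)) φ := by
      have := ((hasDerivAt_id (φ : ℂ)).const_mul (-(Complex.I * z))).cexp.comp_ofReal
      simpa using this
    convert! h2.mul h1 using 1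
    ring
  have hconst := isOpen_Ioo.is_const_of_deriv_eq_zero isPreconnected_Ioo
    (fun φ hφ => (hd φ hφ).differentiableAt.differentiableWithinAt)
    (fun φ hφ => (hd φ hφ).deriv) hθ (y := 0) ⟨by linarith [Real.pi_pos], Real.pi_pos⟩
  have hK0 : K 0 = Real.pi * z / Complex.sin (Real.pi * z) := by
    rw [← integral_cpow_div_one_add_sq hz1 hz2 hz0, hK]
    simp [div_eq_mul_inv, add_comm]
  simp only [Complex.ofReal_zero, mul_zero, Complex.exp_zero, one_mul, hK0] at hconst
  change K θ = _
  rw [← hconst, ← mul_assoc, ← Complex.exp_add]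
  simp

theorem ofReal_poisson_eq_sub {s θ : ℝ} (hs : 0 < s)
    (hθ : θ ∈ Ioo (-Real.pi) Real.pi) :
    ((s * Real.sin θ / (Real.pi * (s ^ 2 + 2 * s * Real.cos θ + 1)) : ℝ) : ℂ) =
      (2 * Real.pi * Complex.I)⁻¹ *
        (Complex.exp (θ * Complex.I) / (s + Complex.exp (θ * Complex.I)) -
          Complex.exp ((-θ : ℝ) * Complex.I) / (s + Complex.exp ((-θ : ℝ) * Complex.I))) := by
  have h1 := add_exp_ne_zero hs hθ
  have h2 := add_exp_ne_zero (θ := -θ) hs ⟨by linarith [hθ.2], by linarith [hθ.1]⟩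
  have hpi : (Real.pi : ℂ) ≠ 0 := by exact_mod_cast Real.pi_ne_zero
  have hee : Complex.exp (θ * Complex.I) * Complex.exp ((-θ : ℝ) * Complex.I) = 1 := by
    rw [← Complex.exp_add]; simp
  have hden : ((s : ℂ) ^ 2 + 2 * s * Complex.cos θ + 1) =
      (s + Complex.exp (θ * Complex.I)) * (s + Complex.exp ((-θ : ℝ) * Complex.I)) := by
    rw [Complex.cos]
    push_cast at hee ⊢
    linear_combination -hee
  rw [div_sub_div _ _ h1 h2]
  push_cast at hden h1 h2 ⊢
  rw [hden, Complex.sin]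
  field_simp
  rw [Complex.I_sq]
  ring

theorem cos_half_sq_mul_le (s θ : ℝ) :
    Real.cos (θ / 2) ^ 2 * (1 + s) ^ 2 ≤ s ^ 2 + 2 * s * Real.cos θ + 1 := by
  have h : Real.cos θ = 2 * Real.cos (θ / 2) ^ 2 - 1 := by
    rw [← Real.cos_two_mul]; congr 1; ring
  rw [h]
  nlinarith [mul_nonneg (sub_nonneg.2 (Real.cos_sq_le_one (θ / 2))) (sq_nonneg (s - 1))]

theorem norm_cpow_mul_poisson_le (z : ℂ) {s θ : ℝ} (hs : 0 < s)
    (hθ : θ ∈ Ioo (-Real.pi) Real.pi) :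
    ‖(s : ℂ) ^ (z - 1) *
      ((s * Real.sin θ / (Real.pi * (s ^ 2 + 2 * s * Real.cos θ + 1)) : ℝ) : ℂ)‖ ≤
      (Real.cos (θ / 2) ^ 2)⁻¹ * ‖(s : ℂ) ^ z / (1 + (s : ℂ)) ^ 2‖ := by
  have hc := pow_pos (cos_half_pos hθ) 2
  have hle := cos_half_sq_mul_le s θ
  have hpos : 0 < s ^ 2 + 2 * s * Real.cos θ + 1 := lt_of_lt_of_le (by positivity) hle
  have hs' : (s : ℂ) ≠ 0 := by exact_mod_cast hs.ne'
  have heq : (s : ℂ) ^ (z - 1) *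
      ((s * Real.sin θ / (Real.pi * (s ^ 2 + 2 * s * Real.cos θ + 1)) : ℝ) : ℂ) =
      (s : ℂ) ^ z * ((Real.sin θ : ℂ) /
        ((Real.pi * (s ^ 2 + 2 * s * Real.cos θ + 1) : ℝ) : ℂ)) := by
    rw [Complex.cpow_sub _ _ hs', Complex.cpow_one, Complex.ofReal_div, Complex.ofReal_mul]
    field_simp
  rw [heq]
  have hv : 0 < Real.pi * (s ^ 2 + 2 * s * Real.cos θ + 1) := mul_pos Real.pi_pos hpos
  refine norm_cpow_mul_div_le z hs (by exact_mod_cast hv.ne') ?_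
  rw [Complex.norm_real, Complex.norm_real, Real.norm_eq_abs, Real.norm_of_nonneg hv.le,
    inv_mul_eq_div, le_div_iff₀ hc]
  calc |Real.sin θ| * (1 + s) ^ 2 * Real.cos (θ / 2) ^ 2
      = |Real.sin θ| * (Real.cos (θ / 2) ^ 2 * (1 + s) ^ 2) := by ring
    _ ≤ Real.pi * (s ^ 2 + 2 * s * Real.cos θ + 1) :=
        mul_le_mul ((Real.abs_sin_le_one θ).trans (by linarith [Real.pi_gt_three])) hle
          (by positivity) Real.pi_pos.le

theorem integrableOn_cpow_mul_poisson {z : ℂ} (hz1 : -1 < z.re) (hz2 : z.re < 1)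
    {θ : ℝ} (hθ : θ ∈ Ioo (-Real.pi) Real.pi) :
    IntegrableOn (fun s : ℝ => (s : ℂ) ^ (z - 1) *
      ((s * Real.sin θ / (Real.pi * (s ^ 2 + 2 * s * Real.cos θ + 1)) : ℝ) : ℂ)) (Ioi 0) := by
  refine integrableOn_of_norm_le_cpow_div hz1 hz2 ?_ _
    fun s hs => norm_cpow_mul_poisson_le z hs hθ
  refine (continuousOn_ofReal_cpow_Ioi _).mul (Complex.continuous_ofReal.comp_continuousOn
    (ContinuousOn.div (by fun_prop) (by fun_prop) fun s hs => ?_))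
  have hs : 0 < s := hs
  have hc := pow_pos (cos_half_pos hθ) 2
  exact (mul_pos Real.pi_pos (lt_of_lt_of_le (by positivity) (cos_half_sq_mul_le s θ))).ne'

theorem integral_cpow_mul_poisson {z : ℂ} (hz1 : -1 < z.re) (hz2 : z.re < 1)
    (hz0 : z ≠ 0) {θ : ℝ} (hθ : θ ∈ Ioo (-Real.pi) Real.pi) :
    ∫ s in Ioi (0 : ℝ), (s : ℂ) ^ (z - 1) *
      ((s * Real.sin θ / (Real.pi * (s ^ 2 + 2 * s * Real.cos θ + 1)) : ℝ) : ℂ) =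
      Complex.sin (θ * z) / Complex.sin (Real.pi * z) := by
  have hθ' : -θ ∈ Ioo (-Real.pi) Real.pi := ⟨by linarith [hθ.2], by linarith [hθ.1]⟩
  have hpi : (Real.pi : ℂ) ≠ 0 := by exact_mod_cast Real.pi_ne_zero
  have hP := (integrableOn_cpow_mul_poisson hz1 hz2 hθ).const_mul z
  have h1 := integrableOn_cpow_mul_exp_div_sq hz1 hz2 hθ
  have h2 := integrableOn_cpow_mul_exp_div_sq hz1 hz2 hθ'
  have hD := (h1.sub h2).const_mul (2 * Real.pi * Complex.I)⁻¹
  have key := integral_deriv_eq_zero_of_norm_le_cpow_div hz1 hz2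
    (f := fun s : ℝ => (s : ℂ) ^ z * ((2 * Real.pi * Complex.I)⁻¹ *
        (Complex.exp (θ * Complex.I) / (s + Complex.exp (θ * Complex.I)) -
          Complex.exp ((-θ : ℝ) * Complex.I) / (s + Complex.exp ((-θ : ℝ) * Complex.I)))))
    ?_ (hP.sub hD) ((Real.cos (θ / 2) ^ 2)⁻¹) ?_
  · simp only [Pi.sub_apply] at key hD
    rw [integral_sub hP hD, integral_const_mul, integral_const_mul, integral_sub h1 h2,
      integral_cpow_mul_exp_div_sq hz1 hz2 hz0 hθ, integral_cpow_mul_exp_div_sq hz1 hz2 hz0 hθ',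
      sub_eq_zero] at key
    refine mul_left_cancel₀ hz0 (key.trans ?_)
    rw [show Complex.sin (θ * z) = (Complex.exp (-(θ * z) * Complex.I) -
      Complex.exp (θ * z * Complex.I)) * Complex.I / 2 from rfl]
    push_cast
    rw [show Complex.I * z * -(θ : ℂ) = -(θ * z) * Complex.I by ring,
      show Complex.I * z * (θ : ℂ) = θ * z * Complex.I by ring]
    field_simp
    rw [Complex.I_sq]
    ring
  · intro s hs
    have hne1 := add_exp_ne_zero hs hθ
    have hne2 := add_exp_ne_zero hs hθ'
    have hid : HasDerivAt (fun s : ℝ => (s : ℂ)) 1 s := Complex.ofRealCLM.hasDerivAt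
    rw [Pi.sub_apply, ofReal_poisson_eq_sub hs hθ]
    have d : ∀ e : ℂ, (s : ℂ) + e ≠ 0 →
        HasDerivAt (fun s : ℝ => e / ((s : ℂ) + e)) (-(e / ((s : ℂ) + e) ^ 2)) s := by
      intro e he
      convert! (hasDerivAt_const s e).div (hid.add_const e) he using 1
      ring
    convert! (hasDerivAt_ofReal_cpow hs).mul
      (((d _ hne1).sub (d _ hne2)).const_mul (2 * Real.pi * Complex.I)⁻¹) using 1
    simp only [Pi.sub_apply]
    ring
  · intro s hs
    have hs' : (s : ℂ) ≠ 0 := by exact_mod_cast hs.ne'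
    rw [← ofReal_poisson_eq_sub hs hθ, mul_left_comm]
    have hz : (s : ℂ) ^ z = s * (s : ℂ) ^ (z - 1) := by
      rw [Complex.cpow_sub _ _ hs', Complex.cpow_one]
      field_simp
    rw [hz, mul_assoc, norm_mul, Complex.norm_real, Real.norm_of_nonneg hs.le, ← hz]
    gcongr
    exact norm_cpow_mul_poisson_le z hs hθ

/-- For `α ∈ (0,2π)`, `α ≠ π`, and `z` with `−1 < Re z < 1`, `z ≠ 0`, the Mellin
integral of the corner kernel `s ↦ (s sin α)/(π(s² − 2s cos α + 1))` converges absolutely and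
equals `sin((π−α)z)/sin(πz)`. -/
theorem mellin_corner_kernel (α : ℝ) (hα0 : 0 < α) (hα2π : α < 2 * Real.pi)
    (hαπ : α ≠ Real.pi) (z : ℂ) (hz1 : -1 < z.re) (hz2 : z.re < 1) (hz0 : z ≠ 0) :
    IntegrableOn
      (fun s : ℝ =>
        (s : ℂ) ^ (z - 1) *
          ((s * Real.sin α / (Real.pi * (s ^ 2 - 2 * s * Real.cos α + 1)) : ℝ) : ℂ))
      (Ioi 0) ∧
    (∫ s in Ioi (0 : ℝ),
        (s : ℂ) ^ (z - 1) *
          ((s * Real.sin α / (Real.pi * (s ^ 2 - 2 * s * Real.cos α + 1)) : ℝ) : ℂ))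
      = Complex.sin (((Real.pi - α : ℝ) : ℂ) * z) / Complex.sin ((Real.pi : ℂ) * z) := by
  have hθ : Real.pi - α ∈ Ioo (-Real.pi) Real.pi := ⟨by linarith, by linarith⟩
  have h1 := integrableOn_cpow_mul_poisson hz1 hz2 hθ
  have h2 := integral_cpow_mul_poisson hz1 hz2 hz0 hθ
  simp only [Real.sin_pi_sub, Real.cos_pi_sub, mul_neg, ← sub_eq_add_neg] at h1 h2
  exact ⟨h1, h2⟩
end

section
/- Let 0 < α < π and let K̂_α(z) = sin((π−α)z)/sin(πz). Then K̂_α is injective on the open half-strip {z ∈ ℂ : |Re z| < 1/2 and Im z < 0} (note that sin(πz) ≠ 0 there, so K̂_α is well defined and holomorphic on this set). -/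
open Complex Set Filter Topology

theorem Complex.sinh_re (z : ℂ) : (sinh z).re = Real.sinh z.re * Real.cos z.im := by
  conv_lhs => rw [← re_add_im z, sinh_add, sinh_mul_I, cosh_mul_I]
  simp [← ofReal_sin, ← ofReal_cos, ← ofReal_sinh, ← ofReal_cosh]

theorem Complex.sinh_im (z : ℂ) : (sinh z).im = Real.cosh z.re * Real.sin z.im := by
  conv_lhs => rw [← re_add_im z, sinh_add, sinh_mul_I, cosh_mul_I]
  simp [← ofReal_sin, ← ofReal_cos, ← ofReal_sinh, ← ofReal_cosh]

theorem Complex.cosh_re (z : ℂ) : (cosh z).re = Real.cosh z.re * Real.cos z.im := by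
  conv_lhs => rw [← re_add_im z, cosh_add, sinh_mul_I, cosh_mul_I]
  simp [← ofReal_sin, ← ofReal_cos, ← ofReal_sinh, ← ofReal_cosh]

theorem Complex.cosh_im (z : ℂ) : (cosh z).im = Real.sinh z.re * Real.sin z.im := by
  conv_lhs => rw [← re_add_im z, cosh_add, sinh_mul_I, cosh_mul_I]
  simp [← ofReal_sin, ← ofReal_cos, ← ofReal_sinh, ← ofReal_cosh]

theorem Complex.norm_sinh_le (z : ℂ) : ‖sinh z‖ ≤ Real.cosh z.re := by
  have h := norm_sub_le (exp z) (exp (-z))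
  rw [← two_sinh, norm_mul, norm_exp, norm_exp, neg_re] at h
  rw [Real.cosh_eq]
  norm_num at h
  linarith

theorem Complex.norm_cosh_le (z : ℂ) : ‖cosh z‖ ≤ Real.cosh z.re := by
  have h := norm_add_le (exp z) (exp (-z))
  rw [← two_cosh, norm_mul, norm_exp, norm_exp, neg_re] at h
  rw [Real.cosh_eq]
  norm_num at h
  linarith

theorem Complex.sinh_re_le_norm_sinh (z : ℂ) : Real.sinh z.re ≤ ‖sinh z‖ := by
  have h := norm_sub_norm_le (exp z) (exp (-z))
  rw [← two_sinh, norm_mul, norm_exp, norm_exp, neg_re] at h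
  rw [Real.sinh_eq]
  norm_num at h
  linarith

theorem Complex.sinh_ne_zero_of_abs_im_lt_pi {z : ℂ} (hz : z ≠ 0) (him : |z.im| < Real.pi) :
    sinh z ≠ 0 := by
  intro h
  have hi := sinh_im z
  have hr := sinh_re z
  rw [h] at hi hr
  have hs : Real.sin z.im = 0 := by
    simpa [(Real.cosh_pos z.re).ne'] using hi.symm
  have hy : z.im = 0 :=
    (Real.sin_eq_zero_iff_of_lt_of_lt (abs_lt.1 him).1 (abs_lt.1 him).2).1 hs
  have hx : z.re = 0 := by simpa [hy] using hr.symm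
  exact hz (Complex.ext hx hy)

/-- A holomorphic function whose derivative has negative real part on a convex set is injective
there (Noshiro--Warschawski). -/
theorem Complex.injOn_of_re_deriv_neg {f : ℂ → ℂ} {s : Set ℂ} (hs : Convex ℝ s)
    (hd : ∀ z ∈ s, DifferentiableAt ℂ f z) (hf : ∀ z ∈ s, (deriv f z).re < 0) : s.InjOn f := by
  intro v hv u hu huv
  by_contra hne
  let γ : ℝ → ℂ := fun t => v + t * (u - v)
  have hγs : ∀ t ∈ Icc (0 : ℝ) 1, γ t ∈ s := fun t ht => by
    have := hs.add_smul_sub_mem hv hu ht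
    simpa [γ] using this
  have hγ : ∀ t : ℝ, HasDerivAt γ (u - v) t := fun t => by
    simpa [γ] using ((hasDerivAt_id t).ofReal_comp.mul_const (u - v)).const_add v
  have hh : ∀ t ∈ Icc (0 : ℝ) 1, HasDerivAt (fun t => (f (γ t) * (starRingEnd ℂ) (u - v)).re)
      (normSq (u - v) * (deriv f (γ t)).re) t := fun t ht => by
    have h1 := ((hd _ (hγs t ht)).hasDerivAt.comp t (hγ t)).mul_const ((starRingEnd ℂ) (u - v))
    have h2 := reCLM.hasFDerivAt.comp_hasDerivAt t h1
    refine h2.congr_deriv ?_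
    rw [mul_assoc, mul_conj, mul_comm]
    simp
  obtain ⟨t, ht, h⟩ := exists_hasDerivAt_eq_slope _ _ zero_lt_one
    (fun t ht => (hh t ht).continuousAt.continuousWithinAt)
    (fun t ht => hh t (Ioo_subset_Icc_self ht))
  have h0 : normSq (u - v) * (deriv f (γ t)).re = 0 := by
    rw [h]; simp [γ, huv]
  have hpos : 0 < normSq (u - v) := normSq_pos.2 (sub_ne_zero.2 (Ne.symm hne))
  have := hf _ (hγs t (Ioo_subset_Icc_self ht))
  nlinarith

/-- The quotient `sinh (c z) / sinh z`, with its removable singularity at `0` filled in. -/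
noncomputable def sinhRatio (c : ℝ) (z : ℂ) : ℂ :=
  dslope (fun w : ℂ => sinh (c * w)) 0 z / dslope sinh 0 z

namespace sinhRatio

variable {c : ℝ} {z : ℂ}

theorem eq_div (hz : z ≠ 0) : sinhRatio c z = sinh (c * z) / sinh z := by
  rw [sinhRatio, dslope_of_ne _ hz, dslope_of_ne _ hz, slope_def_field, slope_def_field]
  simp only [mul_zero, sinh_zero, sub_zero]
  exact div_div_div_cancel_right₀ hz _ _

theorem neg (c : ℝ) (z : ℂ) : sinhRatio c (-z) = sinhRatio c z := by
  rcases eq_or_ne z 0 with rfl | hz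
  · simp
  · rw [eq_div hz, eq_div (neg_ne_zero.2 hz), mul_neg, sinh_neg, sinh_neg, neg_div_neg_eq]

theorem isOpen_strip : IsOpen {z : ℂ | |z.im| < Real.pi} :=
  isOpen_lt (by fun_prop) continuous_const

theorem differentiableOn (c : ℝ) :
    DifferentiableOn ℂ (sinhRatio c) {z : ℂ | |z.im| < Real.pi} := by
  refine DifferentiableOn.div (s := {z : ℂ | |z.im| < Real.pi}) ?_ ?_ ?_
  · exact ((differentiableOn_dslope univ_mem).2
      (by fun_prop : Differentiable ℂ fun w : ℂ => sinh (c * w)).differentiableOn).mono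
        (subset_univ _)
  · exact ((differentiableOn_dslope univ_mem).2 differentiable_sinh.differentiableOn).mono
        (subset_univ _)
  · intro z hz
    rcases eq_or_ne z 0 with rfl | h0
    · simp
    · rw [dslope_of_ne _ h0, slope_def_field]
      simpa [h0] using sinh_ne_zero_of_abs_im_lt_pi h0 hz

theorem deriv_zero (c : ℝ) : deriv (sinhRatio c) 0 = 0 := by
  have h := deriv_comp_neg (sinhRatio c) 0
  simp only [neg] at h
  rw [neg_zero] at h
  exact self_eq_neg.1 h

theorem deriv_eq (hz : z ≠ 0) (him : |z.im| < Real.pi) :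
    deriv (sinhRatio c) z
      = (c * cosh (c * z) * sinh z - sinh (c * z) * cosh z) / sinh z ^ 2 := by
  have hs := sinh_ne_zero_of_abs_im_lt_pi hz him
  have heq : sinhRatio c =ᶠ[𝓝 z] fun w => sinh (c * w) / sinh w := by
    filter_upwards [isOpen_ne.mem_nhds hz] with w hw using eq_div hw
  rw [heq.deriv_eq]
  have h1 : HasDerivAt (fun w : ℂ => sinh (c * w)) (cosh (c * z) * (c * 1)) z :=
    ((hasDerivAt_id z).const_mul (c : ℂ)).csinh
  refine (h1.div (hasDerivAt_sinh z) hs).deriv.trans ?_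
  ring

theorem re_deriv_of_re_eq_zero (hre : z.re = 0) (him : |z.im| < Real.pi) :
    (deriv (sinhRatio c) z).re = 0 := by
  rcases eq_or_ne z 0 with rfl | hz
  · simp [deriv_zero]
  rw [deriv_eq hz him]
  have h : sinh z ^ 2 = ((-Real.sin z.im ^ 2 : ℝ) : ℂ) := by
    apply Complex.ext <;> simp [pow_two, sinh_re, sinh_im, hre, -ofReal_mul, -ofReal_neg]
  rw [h, div_ofReal_re]
  simp [sinh_re, sinh_im, cosh_re, cosh_im, hre]

theorem re_deriv_neg_of_abs_im_eq (hc0 : 0 < c) (hc1 : c < 1) (hre : 0 < z.re)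
    (him : |z.im| = Real.pi / 2) : (deriv (sinhRatio c) z).re < 0 := by
  have hpi := Real.pi_pos
  have hz : z ≠ 0 := fun h => by simp [h] at hre
  rw [deriv_eq hz (by linarith)]
  have hcos : Real.cos z.im = 0 := by rw [← Real.cos_abs, him, Real.cos_pi_div_two]
  have hsin : Real.sin z.im ^ 2 = 1 := by
    have := Real.sin_sq_add_cos_sq z.im
    rw [hcos] at this
    linarith
  have h : sinh z ^ 2 = ((-Real.cosh z.re ^ 2 : ℝ) : ℂ) := by
    apply Complex.ext
    · simp only [pow_two, mul_re, sinh_re, sinh_im, hcos, ofReal_re]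
      linear_combination (-Real.cosh z.re ^ 2) * hsin
    · simp only [pow_two, mul_im, sinh_re, sinh_im, hcos, ofReal_im]
      ring
  have hprod : 0 < Real.sin (c * z.im) * Real.sin z.im := by
    have key : Real.sin (c * z.im) * Real.sin z.im = Real.sin (c * |z.im|) * Real.sin |z.im| := by
      rcases abs_choice z.im with h | h <;> simp [h]
    rw [key, him, Real.sin_pi_div_two, mul_one]
    exact Real.sin_pos_of_pos_of_lt_pi (by positivity) (by nlinarith)
  rw [h, div_ofReal_re]
  refine div_neg_of_pos_of_neg ?_ (neg_lt_zero.2 (pow_pos (Real.cosh_pos _) 2))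
  simp only [sub_re, mul_re, mul_im, sinh_re, sinh_im, cosh_re, cosh_im, ofReal_re, ofReal_im,
    hcos, zero_mul, sub_zero, add_zero, mul_zero, zero_sub]
  have hS : 0 < Real.sinh (c * z.re) := Real.sinh_pos_iff.2 (by positivity)
  have hd : 0 < Real.sinh (z.re - c * z.re) := Real.sinh_pos_iff.2 (by nlinarith)
  rw [Real.sinh_sub] at hd
  have hC := Real.cosh_pos z.re
  have hlt : 0 < Real.cosh (c * z.re) * Real.sinh z.re
      - c * (Real.sinh (c * z.re) * Real.cosh z.re) := by
    nlinarith [mul_pos hS hC]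
  have := mul_pos hprod hlt
  linarith

theorem norm_deriv_le (hc0 : 0 < c) (hc1 : c < 1) (hre : 1 ≤ z.re) (him : |z.im| < Real.pi) :
    ‖deriv (sinhRatio c) z‖ ≤ 32 * Real.exp (-((1 - c) * z.re)) := by
  have hz : z ≠ 0 := fun h => by norm_num [h] at hre
  have hx : 0 ≤ z.re := by linarith
  rw [deriv_eq hz him, norm_div, norm_pow]
  have cosh_le {x : ℝ} (hx : 0 ≤ x) : Real.cosh x ≤ Real.exp x := by
    rw [Real.cosh_eq]
    have := Real.exp_le_exp.2 (by linarith : -x ≤ x)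
    linarith
  have hcz : ((c : ℂ) * z).re = c * z.re := by simp
  have hnum : ‖(c : ℂ) * cosh (c * z) * sinh z - sinh (c * z) * cosh z‖
      ≤ 2 * (Real.exp (c * z.re) * Real.exp z.re) := by
    have h1 : ‖(c : ℂ) * cosh (c * z) * sinh z‖ ≤ Real.exp (c * z.re) * Real.exp z.re := by
      rw [norm_mul, norm_mul, norm_real, Real.norm_of_nonneg hc0.le]
      gcongr
      · have := (hcz ▸ norm_cosh_le (c * z)).trans (cosh_le (by positivity))
        nlinarith [norm_nonneg (cosh (c * z))]
      · exact (norm_sinh_le z).trans (cosh_le hx)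
    have h2 : ‖sinh (c * z) * cosh z‖ ≤ Real.exp (c * z.re) * Real.exp z.re := by
      rw [norm_mul]
      gcongr
      · exact (hcz ▸ norm_sinh_le (c * z)).trans (cosh_le (by positivity))
      · exact (norm_cosh_le z).trans (cosh_le hx)
    linarith [norm_sub_le ((c : ℂ) * cosh (c * z) * sinh z) (sinh (c * z) * cosh z)]
  have hden : Real.exp z.re / 4 ≤ ‖sinh z‖ := by
    refine le_trans ?_ (sinh_re_le_norm_sinh z)
    rw [Real.sinh_eq]
    have h1 : Real.exp (-z.re) ≤ 1 := Real.exp_le_one_iff.2 (by linarith)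
    have h2 := Real.add_one_le_exp z.re
    linarith
  calc _ ≤ 2 * (Real.exp (c * z.re) * Real.exp z.re) / (Real.exp z.re / 4) ^ 2 := by gcongr
    _ = 32 * (Real.exp (c * z.re) / Real.exp z.re) := by
      field_simp
      norm_num
    _ = _ := by
      rw [← Real.exp_sub]
      ring_nf

theorem differentiableOn_exp_deriv (c : ℝ) :
    DifferentiableOn ℂ (fun z => exp (deriv (sinhRatio c) z)) {z : ℂ | |z.im| < Real.pi} :=
  ((differentiableOn c).deriv isOpen_strip).cexp

/-- The open half-strip `{z | 0 < re z, |im z| < π / 2}`. -/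
abbrev halfStrip : Set ℂ := Ioi 0 ×ℂ Ioo (-(Real.pi / 2)) (Real.pi / 2)

theorem diffContOnCl_exp_deriv (c : ℝ) {s : Set ℝ} :
    DiffContOnCl ℂ (fun z => exp (deriv (sinhRatio c) z))
      (s ×ℂ Ioo (-(Real.pi / 2)) (Real.pi / 2)) := by
  have hpi := Real.pi_pos
  refine ((differentiableOn_exp_deriv c).mono fun z hz => ?_).diffContOnCl
  rw [closure_reProdIm, closure_Ioo (by linarith)] at hz
  have := hz.2
  simp only [mem_preimage, mem_Icc] at this
  change |z.im| < Real.pi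
  exact abs_lt.2 ⟨by linarith, by linarith⟩

theorem re_deriv_nonpos (hc0 : 0 < c) (hc1 : c < 1) (hz : z ∈ halfStrip) :
    (deriv (sinhRatio c) z).re ≤ 0 := by
  have hpi := Real.pi_pos
  refine le_of_forall_pos_le_add fun ε hε => ?_
  rw [zero_add]
  have hlim : Tendsto (fun R : ℝ => 32 * Real.exp (-((1 - c) * R))) atTop (𝓝 0) := by
    have := (Real.tendsto_exp_neg_atTop_nhds_zero.comp
      (tendsto_id.const_mul_atTop (sub_pos.2 hc1))).const_mul 32
    simpa using this
  obtain ⟨R, hRε, hR1, hRz⟩ := ((hlim.eventually_le_const hε).and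
    ((eventually_ge_atTop 1).and (eventually_gt_atTop z.re))).exists
  have hR0 : (0 : ℝ) < R := by linarith
  have hbd : Bornology.IsBounded (Ioo 0 R ×ℂ Ioo (-(Real.pi / 2)) (Real.pi / 2)) :=
    (Metric.isBounded_Ioo _ _).reProdIm (Metric.isBounded_Ioo _ _)
  have hmax := norm_le_of_forall_mem_frontier_norm_le hbd (diffContOnCl_exp_deriv c)
    (C := Real.exp ε) ?_ (subset_closure (mem_reProdIm.2 ⟨⟨hz.1, hRz⟩, hz.2⟩))
  · simpa [norm_exp] using hmax
  intro w hw
  rw [(isOpen_Ioo.reProdIm isOpen_Ioo).frontier_eq, closure_reProdIm, closure_Ioo hR0.ne,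
    closure_Ioo (by linarith)] at hw
  obtain ⟨⟨⟨hw0, hwR⟩, hwl, hwu⟩, hnot⟩ := hw
  have him : |w.im| < Real.pi := abs_lt.2 ⟨by linarith, by linarith⟩
  rw [norm_exp, Real.exp_le_exp]
  rcases hw0.eq_or_lt with h0 | h0
  · rw [re_deriv_of_re_eq_zero h0.symm him]
    exact hε.le
  rcases hwR.eq_or_lt with h1 | h1
  · refine (re_le_norm _).trans ((norm_deriv_le hc0 hc1 (by linarith) him).trans ?_)
    rw [h1]
    exact hRε
  rcases (abs_le.2 ⟨hwl, hwu⟩).eq_or_lt with h2 | h2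
  · exact ((re_deriv_neg_of_abs_im_eq hc0 hc1 h0 h2).trans hε).le
  · exact absurd ⟨⟨h0, h1⟩, abs_lt.1 h2⟩ hnot

theorem convex_halfStrip : Convex ℝ halfStrip :=
  ((convex_Ioi 0).linear_preimage reLm).inter ((convex_Ioo _ _).linear_preimage imLm)

theorem re_deriv_neg (hc0 : 0 < c) (hc1 : c < 1) (hz : z ∈ halfStrip) :
    (deriv (sinhRatio c) z).re < 0 := by
  have hpi := Real.pi_pos
  refine (re_deriv_nonpos hc0 hc1 hz).lt_of_ne fun h0 => ?_
  have hm : IsMaxOn (norm ∘ fun w => exp (deriv (sinhRatio c) w)) halfStrip z := fun w hw => by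
    simpa [norm_exp, h0] using re_deriv_nonpos hc0 hc1 hw
  have heq := norm_eqOn_closure_of_isPreconnected_of_isMaxOn convex_halfStrip.isPreconnected
    (isOpen_Ioi.reProdIm isOpen_Ioo) (diffContOnCl_exp_deriv c) hz hm
  have hp : (⟨1, Real.pi / 2⟩ : ℂ) ∈ closure halfStrip := by
    rw [closure_reProdIm, closure_Ioo (by linarith), closure_Ioi]
    exact mem_reProdIm.2 ⟨zero_le_one' ℝ, by linarith, le_rfl⟩
  have := heq hp
  simp only [Function.comp, Function.const, norm_exp, Real.exp_eq_exp, h0] at this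
  exact (re_deriv_neg_of_abs_im_eq hc0 hc1 (z := ⟨1, Real.pi / 2⟩) one_pos
    (abs_of_pos (by positivity))).ne this

theorem injOn_halfStrip (hc0 : 0 < c) (hc1 : c < 1) : halfStrip.InjOn (sinhRatio c) := by
  have hpi := Real.pi_pos
  refine injOn_of_re_deriv_neg convex_halfStrip (fun z hz => ?_) fun z hz => re_deriv_neg hc0 hc1 hz
  refine (differentiableOn c).differentiableAt (isOpen_strip.mem_nhds ?_)
  have := hz.2
  simp only [mem_preimage, mem_Ioo] at this
  change |z.im| < Real.pi
  exact abs_lt.2 ⟨by linarith, by linarith⟩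

end sinhRatio

/-- For `0 < α < π`, the symbol `K̂_α(z) = sin((π−α)z)/sin(πz)` is injective on
the open half-strip `{z : |Re z| < 1/2, Im z < 0}`. -/
theorem mellin_symbol_injOn_halfStrip (α : ℝ) (hα0 : 0 < α) (hαπ : α < Real.pi) :
    Set.InjOn
      (fun z : ℂ =>
        Complex.sin (((Real.pi - α : ℝ) : ℂ) * z) / Complex.sin ((Real.pi : ℂ) * z))
      {z : ℂ | |z.re| < 1 / 2 ∧ z.im < 0} := by
  have hpi := Real.pi_pos
  have hc0 : 0 < (Real.pi - α) / Real.pi := div_pos (by linarith) hpi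
  have hc1 : (Real.pi - α) / Real.pi < 1 := (div_lt_one hpi).2 (by linarith)
  have hmap : ∀ z ∈ {z : ℂ | |z.re| < 1 / 2 ∧ z.im < 0},
      (Real.pi : ℂ) * z * I ∈ sinhRatio.halfStrip := by
    rintro z ⟨hre, him⟩
    obtain ⟨hl, hu⟩ := abs_lt.1 hre
    refine ⟨?_, ?_⟩
    · simp only [mem_preimage, mem_Ioi, mul_re, mul_im, I_re, I_im, ofReal_re, ofReal_im]
      nlinarith
    · simp only [mem_preimage, mem_Ioo, mul_re, mul_im, I_re, I_im, ofReal_re, ofReal_im]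
      constructor <;> nlinarith
  have hval : ∀ z ∈ {z : ℂ | |z.re| < 1 / 2 ∧ z.im < 0},
      sinhRatio ((Real.pi - α) / Real.pi) (Real.pi * z * I)
        = Complex.sin (((Real.pi - α : ℝ) : ℂ) * z) / Complex.sin ((Real.pi : ℂ) * z) := by
    intro z hz
    have h0 : (Real.pi : ℂ) * z * I ≠ 0 := fun h => by
      have := (hmap z hz).1
      simp [h] at this
    have hp : (Real.pi : ℂ) ≠ 0 := ofReal_ne_zero.2 hpi.ne'
    have harg : (((Real.pi - α) / Real.pi : ℝ) : ℂ) * (Real.pi * z * I)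
        = ((Real.pi - α : ℝ) : ℂ) * z * I := by
      push_cast
      field_simp
    rw [sinhRatio.eq_div h0, harg, sinh_mul_I, sinh_mul_I, mul_div_mul_right _ _ I_ne_zero]
  intro z hz w hw hzw
  have := sinhRatio.injOn_halfStrip hc0 hc1 (hmap z hz) (hmap w hw)
    ((hval z hz).trans (hzw.trans (hval w hw).symm))
  exact mul_left_cancel₀ (ofReal_ne_zero.2 hpi.ne') (mul_right_cancel₀ I_ne_zero this)
end
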